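/- arXiv:2504.19507 — 10 statements merged into one kernel-verified Lean document; each statement's English description precedes it below -/
import Mathlib

section
/- In the Dinkelbach setting, for every real λ one has: U(λ) ≤ 0 if and only if ρ* ≤ λ, and U(λ) < 0 if and only if ρ* < λ. Consequently U(λ) = 0 if and only if λ = ρ*, i.e. ρ* is the unique root of the Dinkelbach transform. -/
/-- Dinkelbach setting: `ρ* = ⨅ i, A i / B i` is the unique root of the Dinkelbach
transform `U λ = ⨅ i, (A i - λ * B i)`, with the sign characterizations. -/
theorem dinkelbach_root_characterization
    {ι : Type*} [Nonempty ι] (A B : ι → ℝ) (a₀ b₁ b₂ : ℝ)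
    (hb₁ : 0 < b₁) (hb₁₂ : b₁ ≤ b₂)
    (hA : ∀ i, a₀ ≤ A i) (hBlo : ∀ i, b₁ ≤ B i) (hBhi : ∀ i, B i ≤ b₂)
    (ρstar : ℝ) (hρ : ρstar = ⨅ i, A i / B i)
    (U : ℝ → ℝ) (hU : ∀ lam, U lam = ⨅ i, (A i - lam * B i)) :
    ∀ lam : ℝ,
      (U lam ≤ 0 ↔ ρstar ≤ lam) ∧
      (U lam < 0 ↔ ρstar < lam) ∧
      (U lam = 0 ↔ lam = ρstar) := by
  intro lam
  have hB : ∀ i, 0 < B i := fun i => lt_of_lt_of_le hb₁ (hBlo i)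
  have hb₂ : 0 < b₂ := lt_of_lt_of_le hb₁ hb₁₂
  have bd1 : BddBelow (Set.range fun i => A i / B i) := by
    refine ⟨-(|a₀| / b₁), ?_⟩
    rintro _ ⟨i, rfl⟩
    show -(|a₀| / b₁) ≤ A i / B i
    rw [le_div_iff₀ (hB i)]
    have h1 : |a₀| / b₁ * b₁ = |a₀| := div_mul_cancel₀ _ hb₁.ne'
    have h2 : |a₀| / b₁ * b₁ ≤ |a₀| / b₁ * B i :=
      mul_le_mul_of_nonneg_left (hBlo i) (by positivity)
    have h3 := neg_abs_le a₀
    have h4 := hA i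
    linarith
  have bd2 : BddBelow (Set.range fun i => A i - lam * B i) := by
    refine ⟨a₀ - |lam| * b₂, ?_⟩
    rintro _ ⟨i, rfl⟩
    show a₀ - |lam| * b₂ ≤ A i - lam * B i
    have h1 : lam * B i ≤ |lam| * B i :=
      mul_le_mul_of_nonneg_right (le_abs_self _) (hB i).le
    have h2 : |lam| * B i ≤ |lam| * b₂ :=
      mul_le_mul_of_nonneg_left (hBhi i) (abs_nonneg _)
    have h4 := hA i
    linarith
  have hlt : U lam < 0 ↔ ρstar < lam := by
    rw [hU, hρ, ciInf_lt_iff bd2, ciInf_lt_iff bd1]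
    refine exists_congr fun i => ?_
    rw [div_lt_iff₀ (hB i), sub_neg]
  have hle : U lam ≤ 0 ↔ ρstar ≤ lam := by
    rw [← not_lt, ← not_lt, not_iff_not]
    constructor
    · intro h
      have key : lam + U lam / b₂ ≤ ρstar := by
        rw [hρ]
        refine le_ciInf fun i => ?_
        rw [le_div_iff₀ (hB i)]
        have h1 : U lam ≤ A i - lam * B i := by
          rw [hU]; exact ciInf_le bd2 i
        have h2 : U lam / b₂ * B i ≤ U lam / b₂ * b₂ :=
          mul_le_mul_of_nonneg_left (hBhi i) (by positivity)
        rw [div_mul_cancel₀ _ hb₂.ne'] at h2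
        linarith
      have : 0 < U lam / b₂ := by positivity
      linarith
    · intro h
      have key : (ρstar - lam) * b₁ ≤ U lam := by
        rw [hU]
        refine le_ciInf fun i => ?_
        have h1 : ρstar ≤ A i / B i := by
          rw [hρ]; exact ciInf_le bd1 i
        rw [le_div_iff₀ (hB i)] at h1
        have h2 : (ρstar - lam) * b₁ ≤ (ρstar - lam) * B i :=
          mul_le_mul_of_nonneg_left (hBlo i) (by linarith)
        linarith
      have : 0 < (ρstar - lam) * b₁ := mul_pos (by linarith) hb₁
      linarith
  refine ⟨hle, hlt, ?_⟩
  constructor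
  · intro h
    exact le_antisymm (not_lt.mp fun h' => (hlt.mpr h').ne h) (hle.mp h.le)
  · intro h
    exact le_antisymm (hle.mpr h.ge) (not_lt.mp fun h' => (hlt.mp h').ne h.symm)
end

section
/- In the Dinkelbach setting, U(ρ*) = 0, and for any index i₀ the following are equivalent: A i₀ − ρ*·B i₀ = 0, and A i₀ / B i₀ = ρ*. Hence an index attains the infimum defining U(ρ*) (with value 0) exactly when it attains the infimum ρ* of the fractional program; optimal solutions of the Dinkelbach-transformed problem at λ = ρ* coincide with optimal solutions of the original fractional problem. -/
/-- Dinkelbach setting: `U(ρ*) = 0` and an index attains the infimum of the transformed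
problem at `λ = ρ*` (with value 0) iff it attains the infimum of the fractional program. -/
theorem dinkelbach_optimal_solutions_coincide
    {ι : Type*} [Nonempty ι] (A B : ι → ℝ) (a₀ b₁ b₂ : ℝ)
    (hb₁ : 0 < b₁) (hb₁₂ : b₁ ≤ b₂)
    (hA : ∀ i, a₀ ≤ A i) (hBlo : ∀ i, b₁ ≤ B i) (hBhi : ∀ i, B i ≤ b₂)
    (ρstar : ℝ) (hρ : ρstar = ⨅ i, A i / B i) :
    (⨅ i, (A i - ρstar * B i)) = 0 ∧
    ∀ i₀ : ι, (A i₀ - ρstar * B i₀ = 0 ↔ A i₀ / B i₀ = ρstar) := by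
  have hB : ∀ i, 0 < B i := fun i => lt_of_lt_of_le hb₁ (hBlo i)
  have hb₂ : 0 < b₂ := lt_of_lt_of_le hb₁ hb₁₂
  have hbdd : BddBelow (Set.range fun i => A i / B i) := by
    refine ⟨-(|a₀| / b₁), ?_⟩
    rintro _ ⟨i, rfl⟩
    show -(|a₀| / b₁) ≤ A i / B i
    rw [le_div_iff₀ (hB i)]
    have h1 : |a₀| / b₁ * b₁ ≤ |a₀| / b₁ * B i :=
      mul_le_mul_of_nonneg_left (hBlo i) (by positivity)
    rw [div_mul_cancel₀ _ hb₁.ne'] at h1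
    linarith [neg_abs_le a₀, hA i]
  have hnn : ∀ i, 0 ≤ A i - ρstar * B i := by
    intro i
    have h : ρstar ≤ A i / B i := hρ ▸ ciInf_le hbdd i
    rw [le_div_iff₀ (hB i)] at h
    linarith
  refine ⟨?_, ?_⟩
  · apply le_antisymm _ (le_ciInf hnn)
    apply le_of_forall_pos_le_add
    intro ε hε
    have hlt : (⨅ i, A i / B i) < ρstar + ε / b₂ := by
      rw [← hρ]
      linarith [div_pos hε hb₂]
    obtain ⟨i, hi⟩ := exists_lt_of_ciInf_lt hlt
    rw [div_lt_iff₀ (hB i)] at hi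
    have h1 : ε / b₂ * B i ≤ ε / b₂ * b₂ :=
      mul_le_mul_of_nonneg_left (hBhi i) (by positivity)
    rw [div_mul_cancel₀ _ hb₂.ne'] at h1
    have h2 : (⨅ i, (A i - ρstar * B i)) ≤ A i - ρstar * B i :=
      ciInf_le ⟨0, by rintro _ ⟨j, rfl⟩; exact hnn j⟩ i
    linarith
  · intro i
    rw [div_eq_iff (hB i).ne', sub_eq_zero]
end

section
/- Let ι be a finite nonempty type, P a row-stochastic matrix on ι, d : ι → ℝ with 0 < d i < 1 for all i, P̃ the state-dependent lazy modification of P, and c := min_i d i > 0. Then for every natural number m and all i, j ∈ ι, the entrywise bound (P̃^m) i j ≥ c^m · (P^m) i j holds. In particular, whenever (P^m) i j > 0 also (P̃^m) i j > 0, so m-step accessibility between states under P is preserved under P̃; this is the recurrent-class-preservation half of Lemma 10. -/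
/-- With `c = min_i d i > 0`, the state-dependent lazy modification `P̃` of `P`
satisfies `(P̃^m) i j ≥ c^m * (P^m) i j`, so `m`-step accessibility under `P` is
preserved under `P̃`. -/
theorem lazy_modification_accessibility
    {ι : Type*} [Fintype ι] [DecidableEq ι] [Nonempty ι]
    (P : Matrix ι ι ℝ)
    (hnonneg : ∀ i j, 0 ≤ P i j) (hrow : ∀ i, ∑ j, P i j = 1)
    (d : ι → ℝ) (hd0 : ∀ i, 0 < d i) (hd1 : ∀ i, d i < 1)
    (Pt : Matrix ι ι ℝ)
    (hPt : ∀ i j, Pt i j = if j = i then 1 - d i + d i * P i i else d i * P i j)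
    (c : ℝ) (hc : c = ⨅ i, d i) :
    (0 < c) ∧
    (∀ (m : ℕ) (i j : ι), c ^ m * (P ^ m) i j ≤ (Pt ^ m) i j) ∧
    (∀ (m : ℕ) (i j : ι), 0 < (P ^ m) i j → 0 < (Pt ^ m) i j) := by
  have hcpos : 0 < c := by
    obtain ⟨i, hi⟩ := exists_eq_ciInf_of_finite (f := d)
    rw [hc, ← hi]
    exact hd0 i
  have hcle : ∀ i, c ≤ d i := fun i => by
    rw [hc]
    exact ciInf_le (Set.finite_range d).bddBelow i
  have hone : ∀ i j, c * P i j ≤ Pt i j := by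
    intro i j
    have h := mul_le_mul_of_nonneg_right (hcle i) (hnonneg i j)
    rw [hPt]
    split_ifs with hij
    · subst hij
      linarith [hd1 j]
    · exact h
  have hPn : ∀ (m : ℕ) (i j : ι), 0 ≤ (P ^ m) i j := by
    intro m
    induction m with
    | zero =>
      intro i j
      rw [pow_zero, Matrix.one_apply]
      split_ifs <;> norm_num
    | succ k ih =>
      intro i j
      rw [pow_succ, Matrix.mul_apply]
      exact Finset.sum_nonneg fun l _ => mul_nonneg (ih i l) (hnonneg l j)
  have main : ∀ (m : ℕ) (i j : ι), c ^ m * (P ^ m) i j ≤ (Pt ^ m) i j := by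
    intro m
    induction m with
    | zero => intro i j; simp
    | succ k ih =>
      intro i j
      rw [pow_succ P, pow_succ Pt, Matrix.mul_apply, Matrix.mul_apply, Finset.mul_sum]
      refine Finset.sum_le_sum fun l _ => ?_
      have h0 : 0 ≤ c ^ k * (P ^ k) i l := mul_nonneg (pow_nonneg hcpos.le k) (hPn k i l)
      have h1 : 0 ≤ c * P l j := mul_nonneg hcpos.le (hnonneg l j)
      calc c ^ (k + 1) * ((P ^ k) i l * P l j)
          = (c ^ k * (P ^ k) i l) * (c * P l j) := by ring
        _ ≤ (Pt ^ k) i l * Pt l j :=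
          mul_le_mul (ih i l) (hone l j) h1 (h0.trans (ih i l))
  exact ⟨hcpos, main, fun m i j h => lt_of_lt_of_le (mul_pos (pow_pos hcpos m) h) (main m i j)⟩
end

section
/- Let ι be a finite nonempty type, P a row-stochastic matrix on ι, d : ι → ℝ with 0 < d i < 1 for all i, and P̃ the state-dependent lazy modification of P. Fix j ∈ ι with P j j < 1, and assume that for all i ≠ j and all integers k, n ≥ 1 one has (P^k) j i · (P^n) i j = 0 (no excursion from j through another state ever returns to j; this holds when j is a transient state of the unichain induced by P). Then (P̃^n) j j = (P̃ j j)^n for every n ≥ 1, and since P̃ j j = 1 − d j·(1 − P j j) < 1, (P̃^n) j j → 0 as n → ∞; thus j is also transient for P̃. This is the transience-preservation half of Lemma 10. -/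
/-- Transience preservation under the lazy modification: if no excursion from `j`
through another state ever returns to `j` under `P`, then `(P̃^n) j j = (P̃ j j)^n`,
`P̃ j j = 1 - d j * (1 - P j j) < 1`, and `(P̃^n) j j → 0`. -/
theorem lazy_modification_transience
    {ι : Type*} [Fintype ι] [DecidableEq ι] [Nonempty ι]
    (P : Matrix ι ι ℝ)
    (hnonneg : ∀ i j, 0 ≤ P i j) (hrow : ∀ i, ∑ j, P i j = 1)
    (d : ι → ℝ) (hd0 : ∀ i, 0 < d i) (hd1 : ∀ i, d i < 1)
    (Pt : Matrix ι ι ℝ)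
    (hPt : ∀ i j, Pt i j = if j = i then 1 - d i + d i * P i i else d i * P i j)
    (j : ι) (hPjj : P j j < 1)
    (hnoret : ∀ i, i ≠ j → ∀ k n : ℕ, 1 ≤ k → 1 ≤ n → (P ^ k) j i * (P ^ n) i j = 0) :
    (∀ n : ℕ, 1 ≤ n → (Pt ^ n) j j = (Pt j j) ^ n) ∧
    Pt j j = 1 - d j * (1 - P j j) ∧
    Pt j j < 1 ∧
    Filter.Tendsto (fun n : ℕ => (Pt ^ n) j j) Filter.atTop (nhds 0) := by
  have hpn : ∀ n : ℕ, ∀ a b, 0 ≤ (P ^ n) a b := by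
    intro n
    induction n with
    | zero =>
      intro a b
      rw [pow_zero, Matrix.one_apply]
      split_ifs <;> norm_num
    | succ n ih =>
      intro a b
      rw [pow_succ', Matrix.mul_apply]
      exact Finset.sum_nonneg fun k _ => mul_nonneg (hnonneg a k) (ih k b)
  have hclosed : ∀ i, (∀ n : ℕ, (P ^ n) i j = 0) → ∀ k, P i k ≠ 0 →
      ∀ n : ℕ, (P ^ n) k j = 0 := by
    intro i hi k hk n
    have h := hi (n + 1)
    rw [pow_succ', Matrix.mul_apply,
      Finset.sum_eq_zero_iff_of_nonneg
        (fun k _ => mul_nonneg (hnonneg i k) (hpn n k j))] at h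
    exact (mul_eq_zero.mp (h k (Finset.mem_univ k))).resolve_left hk
  have hS : ∀ n : ℕ, ∀ i, (∀ n : ℕ, (P ^ n) i j = 0) → (Pt ^ n) i j = 0 := by
    intro n
    induction n with
    | zero =>
      intro i hi
      simpa using hi 0
    | succ n ih =>
      intro i hi
      rw [pow_succ', Matrix.mul_apply]
      refine Finset.sum_eq_zero fun k _ => ?_
      by_cases hki : k = i
      · rw [hki, ih i hi, mul_zero]
      · by_cases hk : P i k = 0
        · rw [hPt, if_neg hki, hk, mul_zero, zero_mul]
        · rw [ih k (hclosed i hi k hk), mul_zero]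
  have hj : ∀ n : ℕ, (Pt ^ n) j j = (Pt j j) ^ n := by
    intro n
    induction n with
    | zero => simp
    | succ n ih =>
      rw [pow_succ', Matrix.mul_apply, Finset.sum_eq_single j, ih, pow_succ']
      · intro k _ hkj
        by_cases hk : P j k = 0
        · rw [hPt, if_neg hkj, hk, mul_zero, zero_mul]
        · rw [hS n k, mul_zero]
          intro m
          rcases Nat.eq_zero_or_pos m with rfl | hm
          · rw [pow_zero, Matrix.one_apply_ne hkj]
          · have h := hnoret k hkj 1 m le_rfl hm
            rw [pow_one] at h
            exact (mul_eq_zero.mp h).resolve_left hk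
      · intro h
        exact absurd (Finset.mem_univ j) h
  have heq : Pt j j = 1 - d j * (1 - P j j) := by
    rw [hPt, if_pos rfl]
    ring
  have hlt : Pt j j < 1 := by
    rw [heq]
    have := mul_pos (hd0 j) (sub_pos.mpr hPjj)
    linarith
  have hge : 0 ≤ Pt j j := by
    rw [hPt, if_pos rfl]
    have := mul_nonneg (hd0 j).le (hnonneg j j)
    have := hd1 j
    linarith
  refine ⟨fun n _ => hj n, heq, hlt, ?_⟩
  simp only [hj]
  exact tendsto_pow_atTop_nhds_zero_of_lt_one hge hlt
end

section
/- Let ι be a finite nonempty type, let P and Q be row-stochastic matrices on ι, let j* ∈ ι and ε ∈ (0,1] satisfy P i j* ≥ ε and Q i j* ≥ ε for every i. Let y : ι → ℝ with y j* = 0, let c ∈ ℝ, and let x : ι → ℝ satisfy c + Σ_j Q i j · y j ≤ x i ≤ c + Σ_j P i j · y j for every i. Then max_i x i − min_i x i ≤ (1−ε)·(max_j y j − min_j y j). (This two-sided span-contraction inequality is the key estimate behind the geometric convergence of the τ-RVI and OnePDSI iterations in Theorems 2, 3, 5 and 6.) -/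
theorem span_aux {ι : Type*} [Fintype ι] (r z : ι → ℝ) (hr : ∀ j, 0 ≤ r j)
    (hs : ∑ j, r j = 1) (k : ι) (ε M : ℝ) (hk : ε ≤ r k) (hz : z k = 0)
    (hM : ∀ j, z j ≤ M) : ∑ j, r j * z j ≤ (1 - ε) * M := by
  have h1 : r k * (M - z k) ≤ ∑ j, r j * (M - z j) :=
    Finset.single_le_sum (f := fun j => r j * (M - z j))
      (fun j _ => mul_nonneg (hr j) (sub_nonneg.2 (hM j))) (Finset.mem_univ k)
  have h2 : ∑ j, r j * (M - z j) = M - ∑ j, r j * z j := by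
    simp only [mul_sub, Finset.sum_sub_distrib, ← Finset.sum_mul, hs, one_mul]
  have h3 : 0 ≤ M := hz ▸ hM k
  rw [h2, hz] at h1
  nlinarith [mul_le_mul_of_nonneg_right hk h3]

/-- Two-sided span-contraction: if both row-stochastic matrices `P`, `Q` put mass at
least `ε` on a column `j*` where `y` vanishes, and `x` is squeezed between
`c + Q·y` and `c + P·y` rowwise, then `span x ≤ (1-ε) * span y`. -/
theorem span_contraction
    {ι : Type*} [Fintype ι] [Nonempty ι]
    (P Q : Matrix ι ι ℝ)
    (hPnn : ∀ i j, 0 ≤ P i j) (hProw : ∀ i, ∑ j, P i j = 1)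
    (hQnn : ∀ i j, 0 ≤ Q i j) (hQrow : ∀ i, ∑ j, Q i j = 1)
    (jStar : ι) (ε : ℝ) (hε0 : 0 < ε) (hε1 : ε ≤ 1)
    (hPmin : ∀ i, ε ≤ P i jStar) (hQmin : ∀ i, ε ≤ Q i jStar)
    (y : ι → ℝ) (hy : y jStar = 0) (c : ℝ) (x : ι → ℝ)
    (hx : ∀ i, c + ∑ j, Q i j * y j ≤ x i ∧ x i ≤ c + ∑ j, P i j * y j) :
    Finset.univ.sup' Finset.univ_nonempty x - Finset.univ.inf' Finset.univ_nonempty x ≤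
      (1 - ε) *
        (Finset.univ.sup' Finset.univ_nonempty y - Finset.univ.inf' Finset.univ_nonempty y) := by
  have hU : Finset.univ.sup' Finset.univ_nonempty x ≤
      c + (1 - ε) * Finset.univ.sup' Finset.univ_nonempty y := by
    refine Finset.sup'_le _ _ fun i _ => (hx i).2.trans ?_
    have := span_aux (P i) y (hPnn i) (hProw i) jStar ε (Finset.univ.sup' Finset.univ_nonempty y) (hPmin i) hy
      (fun j => Finset.le_sup' y (Finset.mem_univ j))
    linarith
  have hL : c + (1 - ε) * Finset.univ.inf' Finset.univ_nonempty y ≤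
      Finset.univ.inf' Finset.univ_nonempty x := by
    refine Finset.le_inf' _ _ fun i _ => le_trans ?_ (hx i).1
    have := span_aux (Q i) (fun j => - y j) (hQnn i) (hQrow i) jStar ε
      (-Finset.univ.inf' Finset.univ_nonempty y) (hQmin i) (by simp [hy])
      (fun j => neg_le_neg (Finset.inf'_le y (Finset.mem_univ j)))
    simp only [mul_neg, Finset.sum_neg_distrib] at this
    linarith
  linarith
end

section
/- Let Γ and Act be finite nonempty types, q : Γ → Act → ℝ, f : Act → ℝ with f a > 0 for all a, P : Γ → Act → Γ → ℝ, γʳ ∈ Γ a reference state, ρ ∈ ℝ, and W : Γ → ℝ with W γʳ = 0. Then the following two systems are equivalent: (a) W γ = min_{a ∈ Act} ( q γ a − ρ·f a + Σ_{γ'} P γ a γ' · W γ' ) for every γ ∈ Γ; (b) W γ = min_{a ∈ Act} ( q γ a − ρ·f a + Σ_{γ'} P γ a γ' · W γ' ) for every γ ≠ γʳ, together with the ratio formula ρ = min_{a ∈ Act} ( ( q γʳ a + Σ_{γ'} P γʳ a γ' · W γ' ) / f a ). (This is the fixed-point reformulation of Theorem 4: solving the Bellman system with zero optimal average cost is equivalent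 to solving the nonlinear fixed-point equations, with the optimal fractional value recovered as a minimum of ratios at the reference state.) -/
theorem eq_inf'_iff_aux {A : Type*} [Fintype A] [Nonempty A] (g : A → ℝ) (c : ℝ) :
    c = Finset.univ.inf' Finset.univ_nonempty g ↔ (∀ a, c ≤ g a) ∧ ∃ a, g a = c := by
  constructor
  · intro h
    refine ⟨fun a => h ▸ Finset.inf'_le g (Finset.mem_univ a), ?_⟩
    obtain ⟨a, -, ha⟩ := Finset.exists_mem_eq_inf' (Finset.univ_nonempty (α := A)) g
    exact ⟨a, by rw [h, ha]⟩
  · rintro ⟨h, a, ha⟩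
    apply le_antisymm
    · exact Finset.le_inf' _ _ fun b _ => h b
    · exact (Finset.inf'_le g (Finset.mem_univ a)).trans ha.le

/-- Fixed-point reformulation (Theorem 4): with `W γʳ = 0`, the Bellman system with
zero optimal average cost holds at every state iff it holds away from the reference
state together with the ratio formula for `ρ` at the reference state. -/
theorem fixed_point_reformulation
    {Γ Act : Type*} [Fintype Γ] [Nonempty Γ] [DecidableEq Γ] [Fintype Act] [Nonempty Act]
    (q : Γ → Act → ℝ) (f : Act → ℝ) (hf : ∀ a, 0 < f a)
    (P : Γ → Act → Γ → ℝ) (γr : Γ) (ρ : ℝ) (W : Γ → ℝ) (hW : W γr = 0) :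
    (∀ γ, W γ = Finset.univ.inf' Finset.univ_nonempty
        (fun a => q γ a - ρ * f a + ∑ γ', P γ a γ' * W γ')) ↔
    ((∀ γ, γ ≠ γr → W γ = Finset.univ.inf' Finset.univ_nonempty
        (fun a => q γ a - ρ * f a + ∑ γ', P γ a γ' * W γ')) ∧
      ρ = Finset.univ.inf' Finset.univ_nonempty
        (fun a => (q γr a + ∑ γ', P γr a γ' * W γ') / f a)) := by
  have key : (W γr = Finset.univ.inf' Finset.univ_nonempty
        (fun a => q γr a - ρ * f a + ∑ γ', P γr a γ' * W γ')) ↔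
      ρ = Finset.univ.inf' Finset.univ_nonempty
        (fun a => (q γr a + ∑ γ', P γr a γ' * W γ') / f a) := by
    rw [hW, eq_inf'_iff_aux, eq_inf'_iff_aux]
    refine and_congr (forall_congr' fun a => ?_) (exists_congr fun a => ?_)
    · rw [le_div_iff₀ (hf a)]
      constructor <;> intro h <;> linarith
    · rw [div_eq_iff (hf a).ne']
      constructor <;> intro h <;> linarith
  rw [← key]
  constructor
  · intro h
    exact ⟨fun γ _ => h γ, h γr⟩
  · rintro ⟨h, hr⟩ γ
    by_cases e : γ = γr
    · rw [e]; exact hr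
    · exact h γ e
end

section
/- Under the Doeblin condition, the τ-RVI iterates converge: the sequence (Ũ_K) converges to a real limit Ũ_∞ and, for each γ ∈ Γ, the sequence (Ṽ_K γ) converges to a real limit Ṽ_∞ γ. Moreover the limits solve the average-cost optimality equation of the τ-modified MDP: for every γ ∈ Γ, Ṽ_∞ γ + Ũ_∞ = (1−τ)·Ṽ_∞ γ + min_{a ∈ Act} ( g γ a + τ·Σ_{γ'} P γ a γ' · Ṽ_∞ γ' ). (Theorem 2: convergence of the τ-RVI algorithm to a solution of the ACOE, which holds even when the relative value iteration without the τ-modification oscillates due to periodicity.) -/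
/-- Row-stochastic matrices. -/
def IsRowSt {Γ : Type*} [Fintype Γ] (Q : Matrix Γ Γ ℝ) : Prop :=
  (∀ x y, 0 ≤ Q x y) ∧ ∀ x, ∑ y, Q x y = 1

theorem IsRowSt.one_mat {Γ : Type*} [Fintype Γ] [DecidableEq Γ] :
    IsRowSt (1 : Matrix Γ Γ ℝ) := by
  refine ⟨fun x y => ?_, fun x => ?_⟩
  · rw [Matrix.one_apply]; split_ifs <;> norm_num
  · simp [Matrix.one_apply]

theorem IsRowSt.mul_mat {Γ : Type*} [Fintype Γ] {A B : Matrix Γ Γ ℝ}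
    (hA : IsRowSt A) (hB : IsRowSt B) : IsRowSt (A * B) := by
  refine ⟨fun x y => ?_, fun x => ?_⟩
  · rw [Matrix.mul_apply]
    exact Finset.sum_nonneg fun z _ => mul_nonneg (hA.1 _ _) (hB.1 _ _)
  · simp only [Matrix.mul_apply]
    rw [Finset.sum_comm]
    simp only [← Finset.mul_sum, hB.2, mul_one, hA.2]

theorem IsRowSt.mono {Γ : Type*} [Fintype Γ] {A : Matrix Γ Γ ℝ} (hA : IsRowSt A)
    {u v : Γ → ℝ} (h : ∀ x, u x ≤ v x) (x : Γ) : (A.mulVec u) x ≤ (A.mulVec v) x := by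
  simp only [Matrix.mulVec, dotProduct]
  exact Finset.sum_le_sum fun y _ => mul_le_mul_of_nonneg_left (h y) (hA.1 _ _)

theorem IsRowSt.sub_const {Γ : Type*} [Fintype Γ] {A : Matrix Γ Γ ℝ} (hA : IsRowSt A)
    (u : Γ → ℝ) (c : ℝ) (x : Γ) : (A.mulVec fun y => u y - c) x = (A.mulVec u) x - c := by
  simp only [Matrix.mulVec, dotProduct, mul_sub, Finset.sum_sub_distrib, ← Finset.sum_mul, hA.2,
    one_mul]

theorem IsRowSt.upper {Γ : Type*} [Fintype Γ] {A : Matrix Γ Γ ℝ} (hA : IsRowSt A)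
    {u : Γ → ℝ} {hi e : ℝ} {s x : Γ} (h : ∀ y, u y ≤ hi) (he : e ≤ A x s) :
    (A.mulVec u) x ≤ hi - e * (hi - u s) := by
  have h1 : A x s * (hi - u s) ≤ ∑ y, A x y * (hi - u y) :=
    Finset.single_le_sum (f := fun y => A x y * (hi - u y))
      (fun y _ => mul_nonneg (hA.1 _ _) (sub_nonneg.2 (h y))) (Finset.mem_univ s)
  have h2 : ∑ y, A x y * (hi - u y) = hi - (A.mulVec u) x := by
    simp only [Matrix.mulVec, dotProduct, mul_sub, Finset.sum_sub_distrib, ← Finset.sum_mul, hA.2,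
      one_mul]
  have h3 := mul_le_mul_of_nonneg_right he (sub_nonneg.2 (h s))
  linarith

theorem IsRowSt.lower {Γ : Type*} [Fintype Γ] {A : Matrix Γ Γ ℝ} (hA : IsRowSt A)
    {u : Γ → ℝ} {lo e : ℝ} {s x : Γ} (h : ∀ y, lo ≤ u y) (he : e ≤ A x s) :
    lo + e * (u s - lo) ≤ (A.mulVec u) x := by
  have h1 : A x s * (u s - lo) ≤ ∑ y, A x y * (u y - lo) :=
    Finset.single_le_sum (f := fun y => A x y * (u y - lo))
      (fun y _ => mul_nonneg (hA.1 _ _) (sub_nonneg.2 (h y))) (Finset.mem_univ s)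
  have h2 : ∑ y, A x y * (u y - lo) = (A.mulVec u) x - lo := by
    simp only [Matrix.mulVec, dotProduct, mul_sub, Finset.sum_sub_distrib, ← Finset.sum_mul, hA.2,
      one_mul]
  have h3 := mul_le_mul_of_nonneg_right he (sub_nonneg.2 (h s))
  linarith

/-- Theorem 2: under the Doeblin condition, the τ-RVI iterates converge, and the limits
solve the average-cost optimality equation of the τ-modified MDP. -/
theorem tauRVI_converges
    {Γ Act : Type*} [Fintype Γ] [Nonempty Γ] [DecidableEq Γ] [Fintype Act] [Nonempty Act]
    (g : Γ → Act → ℝ) (P : Γ → Act → Γ → ℝ)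
    (hPnn : ∀ γ a γ', 0 ≤ P γ a γ') (hProw : ∀ γ a, ∑ γ', P γ a γ' = 1)
    (τ : ℝ) (hτ0 : 0 < τ) (hτ1 : τ < 1)
    (γr : Γ) (V : ℕ → Γ → ℝ) (Useq : ℕ → ℝ)
    (hV0 : V 0 γr = 0)
    (hUrec : ∀ K, Useq (K + 1) = Finset.univ.inf' Finset.univ_nonempty
        (fun a => g γr a + τ * ∑ γ', P γr a γ' * V K γ'))
    (hVrec : ∀ K γ, V (K + 1) γ = (1 - τ) * V K γ +
        Finset.univ.inf' Finset.univ_nonempty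
          (fun a => g γ a + τ * ∑ γ', P γ a γ' * V K γ') - Useq (K + 1))
    (M : (Γ → Act) → Matrix Γ Γ ℝ)
    (hM : ∀ φ γ γ', M φ γ γ' = (1 - τ) * (if γ' = γ then 1 else 0) + τ * P γ (φ γ) γ')
    (L : ℕ) (hL : 1 ≤ L) (ε : ℝ) (hε0 : 0 < ε) (hε1 : ε < 1) (γstar : Γ)
    (hDoeblin : ∀ φ : Fin L → (Γ → Act), ∀ γ,
        ε ≤ ((List.ofFn (fun k => M (φ k))).prod) γ γstar) :
    ∃ (Uinf : ℝ) (Vinf : Γ → ℝ),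
      Filter.Tendsto Useq Filter.atTop (nhds Uinf) ∧
      (∀ γ, Filter.Tendsto (fun K => V K γ) Filter.atTop (nhds (Vinf γ))) ∧
      (∀ γ, Vinf γ + Uinf = (1 - τ) * Vinf γ +
        Finset.univ.inf' Finset.univ_nonempty
          (fun a => g γ a + τ * ∑ γ', P γ a γ' * Vinf γ')) := by
  classical
  have hVr : ∀ K, V K γr = 0 := by
    intro K
    induction K with
    | zero => exact hV0
    | succ K ih => rw [hVrec, ih, hUrec]; ring
  have hMst : ∀ φ, IsRowSt (M φ) := by
    intro φ
    refine ⟨fun x y => ?_, fun x => ?_⟩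
    · rw [hM]
      have := hPnn x (φ x) y
      have : 0 ≤ 1 - τ := by linarith
      split_ifs <;> positivity
    · simp only [hM, Finset.sum_add_distrib, ← Finset.mul_sum, hProw]
      simp
  have hMv : ∀ φ (u : Γ → ℝ) x, ((M φ).mulVec u) x
      = (1 - τ) * u x + τ * ∑ y, P x (φ x) y * u y := by
    intro φ u x
    simp only [Matrix.mulVec, dotProduct, hM, add_mul, Finset.sum_add_distrib, mul_assoc,
      ← Finset.mul_sum]
    simp
  have hpol : ∀ K, ∃ φ : Γ → Act, ∀ γ, Finset.univ.inf' Finset.univ_nonempty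
          (fun a => g γ a + τ * ∑ γ', P γ a γ' * V K γ')
        = g γ (φ γ) + τ * ∑ γ', P γ (φ γ) γ' * V K γ' := by
    intro K
    have : ∀ γ, ∃ a, Finset.univ.inf' Finset.univ_nonempty
          (fun a => g γ a + τ * ∑ γ', P γ a γ' * V K γ')
        = g γ a + τ * ∑ γ', P γ a γ' * V K γ' := by
      intro γ
      obtain ⟨a, -, ha⟩ := Finset.exists_mem_eq_inf' (Finset.univ_nonempty (α := Act))
        (fun a => g γ a + τ * ∑ γ', P γ a γ' * V K γ')
      exact ⟨a, ha⟩
    choose φ hφ using this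
    exact ⟨φ, hφ⟩
  choose φ hφ using hpol
  have hle : ∀ K γ a, Finset.univ.inf' Finset.univ_nonempty
          (fun a => g γ a + τ * ∑ γ', P γ a γ' * V K γ')
        ≤ g γ a + τ * ∑ γ', P γ a γ' * V K γ' := fun K γ a =>
    Finset.inf'_le (fun a => g γ a + τ * ∑ γ', P γ a γ' * V K γ') (Finset.mem_univ a)
  obtain ⟨d, hd⟩ : ∃ d : ℕ → Γ → ℝ, ∀ K γ, d K γ = V (K + 1) γ - V K γ := ⟨_, fun _ _ => rfl⟩
  have hsum : ∀ K γ a, ∑ y, P γ a y * d K y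
      = ∑ y, P γ a y * V (K + 1) y - ∑ y, P γ a y * V K y := by
    intro K γ a
    simp only [hd, mul_sub, Finset.sum_sub_distrib]
  have hup : ∀ K γ, d (K + 1) γ ≤ ((M (φ K)).mulVec (d K)) γ - (Useq (K + 2) - Useq (K + 1)) := by
    intro K γ
    rw [hMv, hsum, hd, hd]
    have h1 := hle (K + 1) γ (φ K γ)
    have h2 := hφ K γ
    have h3 := hVrec (K + 1) γ
    have h4 := hVrec K γ
    rw [h3]
    linarith
  have hlo : ∀ K γ, ((M (φ (K + 1))).mulVec (d K)) γ - (Useq (K + 2) - Useq (K + 1))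
      ≤ d (K + 1) γ := by
    intro K γ
    rw [hMv, hsum, hd, hd]
    have h1 := hle K γ (φ (K + 1) γ)
    have h2 := hφ (K + 1) γ
    have h3 := hVrec (K + 1) γ
    have h4 := hVrec K γ
    rw [h3]
    linarith
  have hpst : ∀ n (ψ : Fin n → (Γ → Act)), IsRowSt ((List.ofFn fun k => M (ψ k)).prod) := by
    intro n
    induction n with
    | zero => intro ψ; simpa using IsRowSt.one_mat
    | succ n ih =>
      intro ψ
      rw [List.ofFn_succ, List.prod_cons]
      exact (hMst _).mul_mat (ih _)
  have hupn : ∀ K n, ∃ ψ : Fin n → (Γ → Act), ∀ γ, d (K + n) γ ≤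
      (((List.ofFn fun k => M (ψ k)).prod).mulVec (d K)) γ - (Useq (K + n + 1) - Useq (K + 1)) := by
    intro K n
    induction n with
    | zero => exact ⟨fun _ => φ 0, fun γ => by simp⟩
    | succ n ih =>
      obtain ⟨ψ, hψ⟩ := ih
      refine ⟨Fin.cons (φ (K + n)) ψ, fun γ => ?_⟩
      rw [List.ofFn_succ, List.prod_cons]
      simp only [Fin.cons_zero, Fin.cons_succ]
      rw [← Matrix.mulVec_mulVec]
      have h1 := hup (K + n) γ
      have h2 := (hMst (φ (K + n))).mono hψ γ
      rw [(hMst (φ (K + n))).sub_const] at h2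
      have e1 : K + (n + 1) = K + n + 1 := by ring
      rw [e1]
      linarith
  have hlon : ∀ K n, ∃ ψ : Fin n → (Γ → Act), ∀ γ, 
      (((List.ofFn fun k => M (ψ k)).prod).mulVec (d K)) γ - (Useq (K + n + 1) - Useq (K + 1))
      ≤ d (K + n) γ := by
    intro K n
    induction n with
    | zero => exact ⟨fun _ => φ 0, fun γ => by simp⟩
    | succ n ih =>
      obtain ⟨ψ, hψ⟩ := ih
      refine ⟨Fin.cons (φ (K + n + 1)) ψ, fun γ => ?_⟩
      rw [List.ofFn_succ, List.prod_cons]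
      simp only [Fin.cons_zero, Fin.cons_succ]
      rw [← Matrix.mulVec_mulVec]
      have h1 := hlo (K + n) γ
      have h2 := (hMst (φ (K + n + 1))).mono hψ γ
      rw [(hMst (φ (K + n + 1))).sub_const] at h2
      have e1 : K + (n + 1) = K + n + 1 := by ring
      rw [e1]
      linarith
  have hcon : ∀ K s, (∃ lo, ∀ γ, lo ≤ d K γ ∧ d K γ ≤ lo + s) →
      ∃ lo, ∀ γ, lo ≤ d (K + L) γ ∧ d (K + L) γ ≤ lo + s * (1 - ε) := by
    rintro K s ⟨lo, h⟩
    obtain ⟨ψ, hψ⟩ := hupn K L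
    obtain ⟨χ, hχ⟩ := hlon K L
    refine ⟨lo + ε * (d K γstar - lo) - (Useq (K + L + 1) - Useq (K + 1)), fun γ => ⟨?_, ?_⟩⟩
    · have := (hpst L χ).lower (fun y => (h y).1) (hDoeblin χ γ)
      linarith [hχ γ]
    · have := (hpst L ψ).upper (fun y => (h y).2) (hDoeblin ψ γ)
      linarith [hψ γ]
  obtain ⟨ρ, hρ0, hρ1, hρL⟩ : ∃ ρ : ℝ, 0 < ρ ∧ ρ < 1 ∧ ρ ^ L = 1 - ε := by
    have h1 : 0 < 1 - ε := by linarith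
    refine ⟨(1 - ε) ^ ((L : ℝ)⁻¹), Real.rpow_pos_of_pos h1 _,
      Real.rpow_lt_one h1.le (by linarith) (by positivity), 
      Real.rpow_inv_natCast_pow h1.le (by omega)⟩
  obtain ⟨C, hC⟩ : ∃ C : ℝ, ∀ K < L, ∀ γ, |d K γ| ≤ C := by
    refine ⟨∑ K ∈ Finset.range L, ∑ γ, |d K γ|, fun K hK γ => ?_⟩
    calc |d K γ| ≤ ∑ γ, |d K γ| :=
          Finset.single_le_sum (f := fun γ => |d K γ|) (fun _ _ => abs_nonneg _) (Finset.mem_univ γ)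
      _ ≤ _ := Finset.single_le_sum (f := fun K => ∑ γ, |d K γ|)
          (fun _ _ => Finset.sum_nonneg fun _ _ => abs_nonneg _) (Finset.mem_range.2 hK)
  have hC0 : 0 ≤ C := (abs_nonneg _).trans (hC 0 (by omega) γr)
  have hgeo : ∀ K, ∃ lo, ∀ γ, lo ≤ d K γ ∧ d K γ ≤ lo + (2 * C / ρ ^ L) * ρ ^ K := by
    intro K
    induction K using Nat.strong_induction_on with
    | _ K ih =>
      by_cases hK : K < L
      · refine ⟨-C, fun γ => ?_⟩
        have h1 := abs_le.1 (hC K hK γ)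
        have h2 : ρ ^ L ≤ ρ ^ K := pow_le_pow_of_le_one hρ0.le hρ1.le hK.le
        have h3 : 2 * C ≤ (2 * C / ρ ^ L) * ρ ^ K := by
          have h4 : 0 < ρ ^ L := by positivity
          calc 2 * C = (2 * C / ρ ^ L) * ρ ^ L := by field_simp
            _ ≤ _ := mul_le_mul_of_nonneg_left h2 (by positivity)
        exact ⟨h1.1, by linarith⟩
      · obtain ⟨J, rfl⟩ : ∃ J, K = J + L := ⟨K - L, by omega⟩
        have := hcon J _ (ih J (by omega))
        rwa [← hρL, mul_assoc, ← pow_add] at this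
  have hcau : CauchySeq V := by
    refine cauchySeq_of_le_geometric ρ (2 * C / ρ ^ L) hρ1 fun K => ?_
    obtain ⟨lo, h⟩ := hgeo K
    rw [dist_pi_le_iff (by positivity)]
    intro γ
    rw [Real.dist_eq, abs_sub_comm, ← hd, abs_le]
    have h0 : d K γr = 0 := by rw [hd, hVr, hVr, sub_zero]
    have h1 := h γ
    have h2 := h γr
    rw [h0] at h2
    constructor <;> linarith
  obtain ⟨W, hW⟩ := cauchySeq_tendsto_of_complete hcau
  have hWγ : ∀ γ, Filter.Tendsto (fun K => V K γ) Filter.atTop (nhds (W γ)) :=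
    tendsto_pi_nhds.1 hW
  have hT : ∀ γ, Filter.Tendsto (fun K => Finset.univ.inf' Finset.univ_nonempty
          (fun a => g γ a + τ * ∑ γ', P γ a γ' * V K γ')) Filter.atTop
      (nhds (Finset.univ.inf' Finset.univ_nonempty
          (fun a => g γ a + τ * ∑ γ', P γ a γ' * W γ'))) := by
    intro γ
    refine Filter.Tendsto.finset_inf'_nhds_apply Finset.univ_nonempty fun a _ => ?_
    exact tendsto_const_nhds.add ((tendsto_finsetSum _ fun y _ => (hWγ y).const_mul _).const_mul τ)
  refine ⟨Finset.univ.inf' Finset.univ_nonempty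
          (fun a => g γr a + τ * ∑ γ', P γr a γ' * W γ'), W, ?_, hWγ, ?_⟩
  · rw [← Filter.tendsto_add_atTop_iff_nat 1]
    simp only [hUrec]
    exact hT γr
  · intro γ
    have h1 := (hWγ γ).comp (Filter.tendsto_add_atTop_nat 1)
    have h2 := (((hWγ γ).const_mul (1 - τ)).add (hT γ)).sub (hT γr)
    have h3 := tendsto_nhds_unique h1 (h2.congr fun K => by
      simp only [Function.comp, hVrec, hUrec])
    linarith
end

section
/- Under the Doeblin condition, the τ-RVI error decays geometrically: there exists a constant M ≥ 0 such that for every K ≥ 1, |Ũ_K − Ũ_∞| ≤ τ·M·(1−ε)^{(K−1)/L} / ( 1 − (1−ε)^{1/L} ), where Ũ_∞ is the limit of the sequence (Ũ_K). In particular the worst-case optimality gap decays as O(1/R^K) with asymptotic rate R = (1−ε)^{−1/L} > 1, so a prescribed accuracy δ is reached within O(log(1/δ)) iterations. (Theorem 3: upper bound on the relative error of τ-RVI.) -/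
open Finset in
theorem rvi_avg_le {Γ : Type*} [Fintype Γ] (q x : Γ → ℝ) (hq : ∀ i, 0 ≤ q i) (hs : ∑ i, q i = 1)
    (s : Γ) (ε b : ℝ) (he : ε ≤ q s) (hx : ∀ i, x i ≤ b) :
    ∑ i, q i * x i ≤ (1 - ε) * b + ε * x s := by
  have h1 : q s * (b - x s) ≤ ∑ i, q i * (b - x i) :=
    Finset.single_le_sum (f := fun i => q i * (b - x i))
      (fun i _ => mul_nonneg (hq i) (by linarith [hx i])) (Finset.mem_univ s)
  have h2 : ∑ i, q i * (b - x i) = b - ∑ i, q i * x i := by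
    simp only [mul_sub, Finset.sum_sub_distrib, ← Finset.sum_mul, hs, one_mul]
  have h3 : ε * (b - x s) ≤ q s * (b - x s) :=
    mul_le_mul_of_nonneg_right he (by linarith [hx s])
  linarith

theorem rvi_le_avg {Γ : Type*} [Fintype Γ] (q x : Γ → ℝ) (hq : ∀ i, 0 ≤ q i) (hs : ∑ i, q i = 1)
    (s : Γ) (ε a : ℝ) (he : ε ≤ q s) (hx : ∀ i, a ≤ x i) :
    (1 - ε) * a + ε * x s ≤ ∑ i, q i * x i := by
  have := rvi_avg_le q (fun i => - x i) hq hs s ε (-a) he (fun i => by linarith [hx i])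
  simp only [mul_neg, Finset.sum_neg_distrib] at this
  linarith

/-- Theorem 3: under the Doeblin condition, the τ-RVI error decays geometrically:
there is a constant `C ≥ 0` with `|Ũ_K − Ũ_∞| ≤ τ·C·(1−ε)^((K−1)/L) / (1 − (1−ε)^(1/L))`
for every `K ≥ 1`, where `Ũ_∞` is the limit of the sequence. -/
theorem tauRVI_geometric_error_bound
    {Γ Act : Type*} [Fintype Γ] [Nonempty Γ] [DecidableEq Γ] [Fintype Act] [Nonempty Act]
    (g : Γ → Act → ℝ) (P : Γ → Act → Γ → ℝ)
    (hPnn : ∀ γ a γ', 0 ≤ P γ a γ') (hProw : ∀ γ a, ∑ γ', P γ a γ' = 1)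
    (τ : ℝ) (hτ0 : 0 < τ) (hτ1 : τ < 1)
    (γr : Γ) (V : ℕ → Γ → ℝ) (Useq : ℕ → ℝ)
    (hV0 : V 0 γr = 0)
    (hUrec : ∀ K, Useq (K + 1) = Finset.univ.inf' Finset.univ_nonempty
        (fun a => g γr a + τ * ∑ γ', P γr a γ' * V K γ'))
    (hVrec : ∀ K γ, V (K + 1) γ = (1 - τ) * V K γ +
        Finset.univ.inf' Finset.univ_nonempty
          (fun a => g γ a + τ * ∑ γ', P γ a γ' * V K γ') - Useq (K + 1))
    (M : (Γ → Act) → Matrix Γ Γ ℝ)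
    (hM : ∀ φ γ γ', M φ γ γ' = (1 - τ) * (if γ' = γ then 1 else 0) + τ * P γ (φ γ) γ')
    (L : ℕ) (hL : 1 ≤ L) (ε : ℝ) (hε0 : 0 < ε) (hε1 : ε < 1) (γstar : Γ)
    (hDoeblin : ∀ φ : Fin L → (Γ → Act), ∀ γ,
        ε ≤ ((List.ofFn (fun k => M (φ k))).prod) γ γstar) :
    ∃ (Uinf : ℝ), Filter.Tendsto Useq Filter.atTop (nhds Uinf) ∧
      ∃ C : ℝ, 0 ≤ C ∧ ∀ K : ℕ, 1 ≤ K →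
        |Useq K - Uinf| ≤
          τ * C * (1 - ε) ^ (((K : ℝ) - 1) / (L : ℝ)) /
            (1 - (1 - ε) ^ ((1 : ℝ) / (L : ℝ))) := by

  classical
  -- stochasticity of the one-step matrices and their products
  have hMnn : ∀ φ γ γ', 0 ≤ M φ γ γ' := by
    intro φ γ γ'
    rw [hM]
    have := mul_nonneg hτ0.le (hPnn γ (φ γ) γ')
    split_ifs <;> linarith
  have hMv : ∀ φ γ (x : Γ → ℝ), ∑ γ', M φ γ γ' * x γ' =
      (1 - τ) * x γ + τ * ∑ γ', P γ (φ γ) γ' * x γ' := by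
    intro φ γ x
    simp only [hM, add_mul, Finset.sum_add_distrib, Finset.mul_sum]
    congr 1
    · simp
    · exact Finset.sum_congr rfl fun i _ => by ring
  have hMrow : ∀ φ γ, ∑ γ', M φ γ γ' = 1 := by
    intro φ γ
    have := hMv φ γ (fun _ => 1)
    simp only [mul_one, hProw] at this
    linarith
  have hprod : ∀ l : List (Γ → Act), (∀ γ γ', 0 ≤ (l.map M).prod γ γ') ∧
      (∀ γ, ∑ γ', (l.map M).prod γ γ' = 1) := by
    intro l
    induction l with
    | nil =>
      refine ⟨fun γ γ' => ?_, fun γ => ?_⟩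
      · simp only [List.map_nil, List.prod_nil, Matrix.one_apply]
        split_ifs <;> norm_num
      · simp [Matrix.one_apply]
    | cons φ l ih =>
      refine ⟨fun γ γ' => ?_, fun γ => ?_⟩
      · simp only [List.map_cons, List.prod_cons, Matrix.mul_apply]
        exact Finset.sum_nonneg fun i _ => mul_nonneg (hMnn _ _ _) (ih.1 _ _)
      · simp only [List.map_cons, List.prod_cons, Matrix.mul_apply]
        rw [Finset.sum_comm]
        simp only [← Finset.mul_sum, ih.2, mul_one, hMrow]
  have hD : ∀ l : List (Γ → Act), l.length = L → ∀ γ, ε ≤ (l.map M).prod γ γstar := by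
    intro l hl γ
    subst hl
    have h := hDoeblin (fun k => l.get k) γ
    have e : List.ofFn (fun k => M (l.get k)) = l.map M := by
      have h2 : List.map M (List.ofFn l.get) = List.ofFn (M ∘ l.get) := List.map_ofFn
      rw [List.ofFn_get] at h2
      exact h2.symm
    rwa [e] at h
  -- the reference state
  have hVr : ∀ K, V K γr = 0 := by
    intro K
    induction K with
    | zero => exact hV0
    | succ K ih => rw [hVrec, ih, ← hUrec]; ring
  set W : ℕ → Γ → ℝ := fun K γ => Finset.univ.inf' Finset.univ_nonempty
          (fun a => g γ a + τ * ∑ γ', P γ a γ' * V K γ') with hW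
  have hWle : ∀ K γ a, W K γ ≤ g γ a + τ * ∑ γ', P γ a γ' * V K γ' := by
    intro K γ a
    exact Finset.inf'_le _ (Finset.mem_univ a)
  have hWex : ∀ K γ, ∃ a, W K γ = g γ a + τ * ∑ γ', P γ a γ' * V K γ' := by
    intro K γ
    obtain ⟨a, -, ha⟩ := Finset.exists_mem_eq_inf' (Finset.univ_nonempty (α := Act))
      (fun a => g γ a + τ * ∑ γ', P γ a γ' * V K γ')
    exact ⟨a, ha⟩
  choose φ hφ using hWex
  have hVrec' : ∀ K γ, V (K + 1) γ = (1 - τ) * V K γ + W K γ - Useq (K + 1) := hVrec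
  have hUrec' : ∀ K, Useq (K + 1) = W K γr := hUrec
  let D : ℕ → Γ → ℝ := fun K γ => V (K + 1) γ - V K γ
  have hDr : ∀ K, D K γr = 0 := fun K => by simp [D, hVr]
  have hsub : ∀ K γ a, ∑ γ', P γ a γ' * D K γ' =
      ∑ γ', P γ a γ' * V (K + 1) γ' - ∑ γ', P γ a γ' * V K γ' := by
    intro K γ a
    simp only [D, mul_sub, Finset.sum_sub_distrib]
  have hWup : ∀ K γ, W (K + 1) γ - W K γ ≤ τ * ∑ γ', P γ (φ K γ) γ' * D K γ' := by
    intro K γ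
    have h1 := hWle (K + 1) γ (φ K γ)
    rw [hφ K γ, hsub]
    linarith
  have hWlo : ∀ K γ, τ * ∑ γ', P γ (φ (K + 1) γ) γ' * D K γ' ≤ W (K + 1) γ - W K γ := by
    intro K γ
    have h1 := hWle K γ (φ (K + 1) γ)
    rw [hφ (K + 1) γ, hsub]
    linarith
  have hDrec : ∀ K γ, D (K + 1) γ + (Useq (K + 2) - Useq (K + 1)) =
      (1 - τ) * D K γ + (W (K + 1) γ - W K γ) := by
    intro K γ
    have h1 := hVrec' (K + 1) γ
    have h2 := hVrec' K γ
    simp only [D]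
    rw [h1]
    linarith
  have hstep : ∀ K n, ∃ l₁ l₂ : List (Γ → Act), l₁.length = n ∧ l₂.length = n ∧ ∃ c : ℝ, ∀ γ,
      ∑ γ', (l₁.map M).prod γ γ' * D K γ' ≤ D (K + n) γ + c ∧
      D (K + n) γ + c ≤ ∑ γ', (l₂.map M).prod γ γ' * D K γ' := by
    intro K n
    induction n with
    | zero =>
      refine ⟨[], [], rfl, rfl, 0, fun γ => ?_⟩
      simp [Matrix.one_apply]
    | succ n ih =>
      obtain ⟨l₁, l₂, h1, h2, c, hc⟩ := ih
      refine ⟨φ (K + n + 1) :: l₁, φ (K + n) :: l₂, by simp [h1], by simp [h2],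
        (Useq (K + n + 2) - Useq (K + n + 1)) + c, fun γ => ?_⟩
      have key : ∀ (ψ : Γ → Act) (l : List (Γ → Act)),
          ∑ γ', ((ψ :: l).map M).prod γ γ' * D K γ' =
          ∑ i, M ψ γ i * ∑ γ', (l.map M).prod i γ' * D K γ' := by
        intro ψ l
        simp only [List.map_cons, List.prod_cons, Matrix.mul_apply, Finset.sum_mul,
          Finset.mul_sum]
        rw [Finset.sum_comm]
        exact Finset.sum_congr rfl fun i _ => Finset.sum_congr rfl fun j _ => by ring
      have key2 : ∀ ψ : Γ → Act, ∑ i, M ψ γ i * (D (K + n) i + c) =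
          (1 - τ) * D (K + n) γ + τ * ∑ γ', P γ (ψ γ) γ' * D (K + n) γ' + c := by
        intro ψ
        simp only [mul_add, Finset.sum_add_distrib, ← Finset.sum_mul, hMrow, one_mul]
        rw [hMv]
      have hr := hDrec (K + n) γ
      have hu := hWup (K + n) γ
      have hl := hWlo (K + n) γ
      have e : K + (n + 1) = K + n + 1 := rfl
      rw [key, key, e]
      constructor
      · have : ∑ i, M (φ (K + n + 1)) γ i * ∑ γ', (l₁.map M).prod i γ' * D K γ' ≤
            ∑ i, M (φ (K + n + 1)) γ i * (D (K + n) i + c) :=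
          Finset.sum_le_sum fun i _ => mul_le_mul_of_nonneg_left (hc i).1 (hMnn _ _ _)
        rw [key2] at this
        linarith
      · have : ∑ i, M (φ (K + n)) γ i * (D (K + n) i + c) ≤
            ∑ i, M (φ (K + n)) γ i * ∑ γ', (l₂.map M).prod i γ' * D K γ' :=
          Finset.sum_le_sum fun i _ => mul_le_mul_of_nonneg_left (hc i).2 (hMnn _ _ _)
        rw [key2] at this
        linarith
  have hcontr : ∀ K s, (∃ a, ∀ γ, a ≤ D K γ ∧ D K γ ≤ a + s) →
      ∃ a, ∀ γ, a ≤ D (K + L) γ ∧ D (K + L) γ ≤ a + (1 - ε) * s := by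
    rintro K s ⟨a, ha⟩
    obtain ⟨l₁, l₂, h1, h2, c, hc⟩ := hstep K L
    refine ⟨(1 - ε) * a + ε * D K γstar - c, fun γ => ?_⟩
    have hlo := rvi_le_avg (fun i => (l₁.map M).prod γ i) (D K) ((hprod l₁).1 γ) ((hprod l₁).2 γ)
      γstar ε a (hD l₁ h1 γ) (fun i => (ha i).1)
    have hup := rvi_avg_le (fun i => (l₂.map M).prod γ i) (D K) ((hprod l₂).1 γ) ((hprod l₂).2 γ)
      γstar ε (a + s) (hD l₂ h2 γ) (fun i => (ha i).2)
    have := hc γ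
    constructor <;> linarith [this.1, this.2]
  -- the rate
  obtain ⟨ρ, hρ⟩ : ∃ ρ : ℝ, ρ = (1 - ε) ^ ((1 : ℝ) / (L : ℝ)) := ⟨_, rfl⟩
  have hL0 : (0 : ℝ) < L := by exact_mod_cast hL
  have hρ0 : 0 < ρ := by rw [hρ]; exact Real.rpow_pos_of_pos (by linarith) _
  have hρ1 : ρ < 1 := by
    rw [hρ]; exact Real.rpow_lt_one (by linarith) (by linarith) (by positivity)
  have hρpow : ∀ n : ℕ, (1 - ε) ^ ((n : ℝ) / (L : ℝ)) = ρ ^ n := by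
    intro n
    rw [hρ, ← Real.rpow_natCast, ← Real.rpow_mul (by linarith)]
    congr 1; ring
  have hρL : ρ ^ L = 1 - ε := by
    rw [← hρpow, div_self hL0.ne', Real.rpow_one]
  obtain ⟨B, hB⟩ : ∃ B : ℝ, B = ∑ j ∈ Finset.range L, ∑ γ, |D j γ| := ⟨_, rfl⟩
  have hB0 : 0 ≤ B := by rw [hB]; positivity
  have hBle : ∀ j < L, ∀ γ, |D j γ| ≤ B := by
    intro j hj γ
    rw [hB]
    calc |D j γ| ≤ ∑ γ, |D j γ| :=
          Finset.single_le_sum (f := fun γ => |D j γ|) (fun i _ => abs_nonneg _) (Finset.mem_univ γ)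
      _ ≤ _ := Finset.single_le_sum (f := fun j => ∑ γ, |D j γ|)
          (fun i _ => by positivity) (Finset.mem_range.2 hj)
  obtain ⟨C, hC⟩ : ∃ C : ℝ, C = 2 * B / ρ ^ L := ⟨_, rfl⟩
  have hC0 : 0 ≤ C := by rw [hC]; positivity
  have hspan : ∀ K, ∃ a, ∀ γ, a ≤ D K γ ∧ D K γ ≤ a + C * ρ ^ K := by
    intro K
    induction K using Nat.strong_induction_on with
    | _ K ih =>
      by_cases hK : K < L
      · refine ⟨-B, fun γ => ?_⟩
        have h1 := abs_le.1 (hBle K hK γ)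
        have h2 : 2 * B ≤ C * ρ ^ K := by
          have h3 : C * ρ ^ L = 2 * B := by rw [hC]; field_simp
          rw [← h3]
          exact mul_le_mul_of_nonneg_left (pow_le_pow_of_le_one hρ0.le hρ1.le hK.le) hC0
        constructor <;> linarith [h1.1, h1.2]
      · obtain ⟨m, rfl⟩ : ∃ m, K = m + L := ⟨K - L, by omega⟩
        have := hcontr m _ (ih m (by omega))
        have e : C * ρ ^ (m + L) = (1 - ε) * (C * ρ ^ m) := by
          rw [pow_add, hρL]; ring
        rw [e]; exact this
  have hDabs : ∀ K γ, |D K γ| ≤ C * ρ ^ K := by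
    intro K γ
    obtain ⟨a, ha⟩ := hspan K
    have h1 := ha γ
    have h2 := ha γr
    rw [hDr] at h2
    exact abs_le.2 ⟨by linarith [h1.1, h2.2], by linarith [h1.2, h2.1]⟩
  have hPabs : ∀ K γ a, |∑ γ', P γ a γ' * D K γ'| ≤ C * ρ ^ K := by
    intro K γ a
    calc |∑ γ', P γ a γ' * D K γ'| ≤ ∑ γ', |P γ a γ' * D K γ'| := Finset.abs_sum_le_sum_abs _ _
      _ ≤ ∑ γ', P γ a γ' * (C * ρ ^ K) := Finset.sum_le_sum fun i _ => by
          rw [abs_mul, abs_of_nonneg (hPnn _ _ _)]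
          exact mul_le_mul_of_nonneg_left (hDabs K i) (hPnn _ _ _)
      _ = C * ρ ^ K := by rw [← Finset.sum_mul, hProw, one_mul]
  have hU : ∀ n, dist (Useq (n + 1)) (Useq (n + 1 + 1)) ≤ τ * C * ρ ^ n := by
    intro n
    rw [dist_comm, Real.dist_eq, hUrec' (n + 1), hUrec' n, mul_assoc]
    have hu := hWup n γr
    have hl := hWlo n γr
    have h1 := mul_le_mul_of_nonneg_left (abs_le.1 (hPabs n γr (φ n γr))).2 hτ0.le
    have h2 := mul_le_mul_of_nonneg_left (abs_le.1 (hPabs n γr (φ (n + 1) γr))).1 hτ0.le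
    exact abs_le.2 ⟨by linarith, by linarith⟩
  obtain ⟨Uinf, hlim⟩ := cauchySeq_tendsto_of_complete
    (cauchySeq_of_le_geometric ρ (τ * C) hρ1 (f := fun n => Useq (n + 1)) hU)
  refine ⟨Uinf, (Filter.tendsto_add_atTop_iff_nat 1).1 hlim, C, hC0, fun K hK => ?_⟩
  obtain ⟨n, rfl⟩ : ∃ n, K = n + 1 := ⟨K - 1, by omega⟩
  have h := dist_le_of_le_geometric_of_tendsto ρ (τ * C) hρ1 (f := fun n => Useq (n + 1)) hU hlim n
  have e : (((n + 1 : ℕ) : ℝ) - 1) = (n : ℝ) := by push_cast; ring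
  rw [e, hρpow, ← hρ, ← Real.dist_eq]
  exact h
end

section
/- Under the Doeblin condition, the OnePDSI iterates converge: the sequence (ρ_K) converges to a real limit ρ_∞ and, for each γ ∈ Γ, the sequence (W_K γ) converges to a real limit W_∞ γ. Moreover the limits solve the fixed-point system: c·W_∞ γ = min_{a ∈ Act} ( q γ a − ρ_∞·f a + c·Σ_{γ'} P γ a γ' · W_∞ γ' ) for every γ ∈ Γ, and ρ_∞ = min_{a ∈ Act} ( ( q γʳ a + c·Σ_{γ'} P γʳ a γ' · W_∞ γ' ) / f a ). (Theorem 5: convergence of the one-layer Primal-Dinkelbach Synchronous Iteration to the solution of the fixed-point equations, with the fixed-point relative value recovered as W* = c·W_∞; this holds even when the naive fixed-point iteration diverges because its operator is merely non-expansive.) -/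
theorem onep_avg {Γ : Type*} [Fintype Γ] (A : Γ → ℝ) (hA : ∀ g, 0 ≤ A g) (hs : ∑ g, A g = 1)
    (ε : ℝ) (gs : Γ) (hε : ε ≤ A gs) (x : Γ → ℝ) (h : ℝ) (hx : ∀ g, x g ≤ h) :
    ∑ g, A g * x g ≤ ε * x gs + (1 - ε) * h := by
  have h1 : A gs * (h - x gs) ≤ ∑ g, A g * (h - x g) :=
    Finset.single_le_sum (f := fun g => A g * (h - x g))
      (fun g _ => mul_nonneg (hA g) (sub_nonneg.2 (hx g))) (Finset.mem_univ gs)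
  have h2 : ∑ g, A g * (h - x g) = h - ∑ g, A g * x g := by
    simp only [mul_sub, Finset.sum_sub_distrib]
    rw [← Finset.sum_mul, hs, one_mul]
  have h3 : ε * (h - x gs) ≤ A gs * (h - x gs) :=
    mul_le_mul_of_nonneg_right hε (sub_nonneg.2 (hx gs))
  nlinarith

theorem onep_prod {Γ : Type*} [Fintype Γ] [DecidableEq Γ] (l : List (Matrix Γ Γ ℝ))
    (h : ∀ A ∈ l, (∀ i j, 0 ≤ A i j) ∧ ∀ i, ∑ j, A i j = 1) :
    (∀ i j, 0 ≤ l.prod i j) ∧ ∀ i, ∑ j, l.prod i j = 1 := by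
  induction l with
  | nil =>
    constructor
    · intro i j
      simp only [List.prod_nil, Matrix.one_apply]
      split_ifs <;> norm_num
    · intro i
      simp [Matrix.one_apply]
  | cons A l ih =>
    obtain ⟨h1, h2⟩ := ih (fun B hB => h B (List.mem_cons_of_mem _ hB))
    obtain ⟨a1, a2⟩ := h A List.mem_cons_self
    constructor
    · intro i j
      rw [List.prod_cons, Matrix.mul_apply]
      exact Finset.sum_nonneg (fun k _ => mul_nonneg (a1 _ _) (h1 _ _))
    · intro i
      simp only [List.prod_cons, Matrix.mul_apply]
      rw [Finset.sum_comm]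
      simp only [← Finset.mul_sum, h2, mul_one, a2]

theorem onep_iter {Γ Φ : Type*} [Fintype Γ] [DecidableEq Γ] (M : Φ → Matrix Γ Γ ℝ)
    (h0 : ∀ φ i j, 0 ≤ M φ i j) (h1 : ∀ φ i, ∑ j, M φ i j = 1)
    (D : ℕ → Γ → ℝ) (r : ℕ → ℝ)
    (hD : ∀ K, ∃ φ, ∀ g, D (K + 1) g ≤ ∑ g', M φ g g' * D K g' - (r (K + 1) - r K))
    (K n : ℕ) : ∃ φ : Fin n → Φ, ∀ g,
      D (K + n) g ≤ ∑ g', (List.ofFn (fun k => M (φ k))).prod g g' * D K g'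
        - (r (K + n) - r K) := by
  induction n with
  | zero =>
    refine ⟨Fin.elim0, fun g => ?_⟩
    simp [Matrix.one_apply]
  | succ n ih =>
    obtain ⟨φ, hφ⟩ := ih
    obtain ⟨ψ, hψ⟩ := hD (K + n)
    refine ⟨Fin.cons ψ φ, fun g => ?_⟩
    have e : (List.ofFn (fun k => M ((Fin.cons ψ φ : Fin (n+1) → Φ) k))).prod
        = M ψ * (List.ofFn (fun k => M (φ k))).prod := by
      simp [List.ofFn_succ]
    rw [e]
    set A := (List.ofFn (fun k => M (φ k))).prod
    have e2 : ∑ g', (M ψ * A) g g' * D K g' = ∑ g', M ψ g g' * ∑ g'', A g' g'' * D K g'' := by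
      simp only [Matrix.mul_apply, Finset.sum_mul, Finset.mul_sum]
      rw [Finset.sum_comm]
      simp only [mul_assoc]
    have e3 : ∑ g', M ψ g g' * D (K + n) g' ≤
        ∑ g', M ψ g g' * (∑ g'', A g' g'' * D K g'' - (r (K + n) - r K)) :=
      Finset.sum_le_sum (fun g' _ => mul_le_mul_of_nonneg_left (hφ g') (h0 _ _ _))
    have e4 : ∑ g', M ψ g g' * (∑ g'', A g' g'' * D K g'' - (r (K + n) - r K))
        = ∑ g', M ψ g g' * ∑ g'', A g' g'' * D K g'' - (r (K + n) - r K) := by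
      simp only [mul_sub _ (∑ g'', _), Finset.sum_sub_distrib]
      rw [← Finset.sum_mul, h1, one_mul]
    have := hψ g
    rw [e2]
    rw [← add_assoc]
    linarith

/-- Theorem 5: under the Doeblin condition, the OnePDSI iterates converge, and the
limits solve the fixed-point system (with relative value `W* = c·W_∞` and the ratio
formula for `ρ_∞` at the reference state). -/
theorem onePDSI_converges
    {Γ Act : Type*} [Fintype Γ] [Nonempty Γ] [DecidableEq Γ] [Fintype Act] [Nonempty Act]
    (q : Γ → Act → ℝ) (f : Act → ℝ) (c : ℝ)
    (hc0 : 0 < c) (hcf : ∀ a, c < f a)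
    (P : Γ → Act → Γ → ℝ)
    (hPnn : ∀ γ a γ', 0 ≤ P γ a γ') (hProw : ∀ γ a, ∑ γ', P γ a γ' = 1)
    (γr : Γ) (W : ℕ → Γ → ℝ) (ρseq : ℕ → ℝ)
    (hW0 : W 0 γr = 0)
    (hρrec : ∀ K, ρseq (K + 1) = W K γr + Finset.univ.inf' Finset.univ_nonempty
        (fun a => (q γr a - c * W K γr + c * ∑ γ', P γr a γ' * W K γ') / f a))
    (hWrec : ∀ K γ, W (K + 1) γ = W K γ + Finset.univ.inf' Finset.univ_nonempty
        (fun a => (q γ a - c * W K γ + c * ∑ γ', P γ a γ' * W K γ') / f a)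
        - ρseq (K + 1))
    (M : (Γ → Act) → Matrix Γ Γ ℝ)
    (hM : ∀ φ γ γ', M φ γ γ' =
      (1 - c / f (φ γ)) * (if γ' = γ then 1 else 0) + (c / f (φ γ)) * P γ (φ γ) γ')
    (L : ℕ) (hL : 1 ≤ L) (ε : ℝ) (hε0 : 0 < ε) (hε1 : ε < 1) (γstar : Γ)
    (hDoeblin : ∀ φ : Fin L → (Γ → Act), ∀ γ,
        ε ≤ ((List.ofFn (fun k => M (φ k))).prod) γ γstar) :
    ∃ (ρinf : ℝ) (Winf : Γ → ℝ),
      Filter.Tendsto ρseq Filter.atTop (nhds ρinf) ∧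
      (∀ γ, Filter.Tendsto (fun K => W K γ) Filter.atTop (nhds (Winf γ))) ∧
      (∀ γ, c * Winf γ = Finset.univ.inf' Finset.univ_nonempty
          (fun a => q γ a - ρinf * f a + c * ∑ γ', P γ a γ' * Winf γ')) ∧
      ρinf = Finset.univ.inf' Finset.univ_nonempty
          (fun a => (q γr a + c * ∑ γ', P γr a γ' * Winf γ') / f a) := by
  classical
  have hf : ∀ a, 0 < f a := fun a => hc0.trans (hcf a)
  have hM0 : ∀ φ i j, 0 ≤ M φ i j := by
    intro φ i j
    rw [hM]
    have h1 : c / f (φ i) ≤ 1 := (div_le_one (hf _)).2 (hcf _).le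
    have h2 : 0 ≤ c / f (φ i) := (div_pos hc0 (hf _)).le
    have h3 := mul_nonneg h2 (hPnn i (φ i) j)
    split_ifs <;> linarith
  have hM1 : ∀ φ i, ∑ j, M φ i j = 1 := by
    intro φ i
    simp only [hM, Finset.sum_add_distrib, ← Finset.mul_sum, hProw]
    simp
  have hMs : ∀ φ i (x : Γ → ℝ), ∑ j, M φ i j * x j
      = x i + (- c * x i + c * ∑ j, P i (φ i) j * x j) / f (φ i) := by
    intro φ i x
    simp only [hM, add_mul, Finset.sum_add_distrib, mul_assoc, ← Finset.mul_sum]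
    simp
    ring
  set G : ℕ → Γ → Act → ℝ := fun K γ a =>
    (q γ a - c * W K γ + c * ∑ γ', P γ a γ' * W K γ') / f a with hG
  have hgr : ∀ K, ∃ φ : Γ → Act, ∀ γ,
      Finset.univ.inf' Finset.univ_nonempty (G K γ) = G K γ (φ γ) := by
    intro K
    have : ∀ γ, ∃ a, Finset.univ.inf' Finset.univ_nonempty (G K γ) = G K γ a := by
      intro γ
      obtain ⟨a, -, ha⟩ := Finset.exists_mem_eq_inf' Finset.univ_nonempty (G K γ)
      exact ⟨a, ha⟩
    choose φ hφ using this
    exact ⟨φ, hφ⟩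
  have hle : ∀ K γ a, Finset.univ.inf' Finset.univ_nonempty (G K γ) ≤ G K γ a :=
    fun K γ a => Finset.inf'_le _ (Finset.mem_univ a)
  have hWrec' : ∀ K γ, W (K + 1) γ = W K γ + Finset.univ.inf' Finset.univ_nonempty (G K γ)
      - ρseq (K + 1) := hWrec
  have hρrec' : ∀ K, ρseq (K + 1) = W K γr +
      Finset.univ.inf' Finset.univ_nonempty (G K γr) := hρrec
  have hWr : ∀ K, W K γr = 0 := by
    intro K
    cases K with
    | zero => exact hW0
    | succ K => rw [hWrec', hρrec']; ring
  have hdiff : ∀ K J φ γ, ∑ j, M φ γ j * (W K j - W J j)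
      = (W K γ + G K γ (φ γ)) - (W J γ + G J γ (φ γ)) := by
    intro K J φ γ
    rw [hMs]
    simp only [hG, mul_sub, Finset.sum_sub_distrib]
    ring
  set D : ℕ → Γ → ℝ := fun K γ => W (K + 1) γ - W K γ with hDdef
  have hU : ∀ K, ∃ φ, ∀ g, D (K + 1) g ≤ ∑ g', M φ g g' * D K g'
      - (ρseq (K + 1 + 1) - ρseq (K + 1)) := by
    intro K
    obtain ⟨φ, hφ⟩ := hgr K
    refine ⟨φ, fun g => ?_⟩
    have h1 := hdiff (K + 1) K φ g
    have h2 := hle (K + 1) g (φ g)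
    have h3 := hφ g
    have h4 := hWrec' K g
    have h5 := hWrec' (K + 1) g
    simp only [hDdef]
    rw [h1]
    linarith
  have hLo : ∀ K, ∃ φ, ∀ g, (fun K g => - D K g) (K + 1) g ≤
      ∑ g', M φ g g' * (fun K g => - D K g) K g'
      - ((fun K => - ρseq (K + 1)) (K + 1) - (fun K => - ρseq (K + 1)) K) := by
    intro K
    obtain ⟨φ, hφ⟩ := hgr (K + 1)
    refine ⟨φ, fun g => ?_⟩
    have h1 := hdiff (K + 1) K φ g
    have h2 := hle K g (φ g)
    have h3 := hφ g
    have h4 := hWrec' K g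
    have h5 := hWrec' (K + 1) g
    simp only [hDdef, mul_neg, Finset.sum_neg_distrib]
    rw [h1]
    linarith
  have hstep : ∀ (n : ℕ) (δ : ℝ) (gs : Γ) (_ : ∀ φ : Fin n → (Γ → Act), ∀ γ,
        δ ≤ ((List.ofFn (fun k => M (φ k))).prod) γ gs) (K : ℕ) (s : ℝ),
      (∃ m, ∀ γ, m ≤ D K γ ∧ D K γ ≤ m + s) →
      (∃ m, ∀ γ, m ≤ D (K + n) γ ∧ D (K + n) γ ≤ m + (1 - δ) * s) := by
    intro n δ gs hδ K s ⟨m, hm⟩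
    obtain ⟨φ, hφ⟩ := onep_iter M hM0 hM1 D (fun K => ρseq (K + 1)) hU K n
    obtain ⟨ψ, hψ⟩ := onep_iter M hM0 hM1 (fun K g => - D K g)
      (fun K => - ρseq (K + 1)) hLo K n
    have hst : ∀ φ : Fin n → (Γ → Act), _ := fun φ =>
      onep_prod (List.ofFn (fun k => M (φ k))) (by
        intro A hA
        rw [List.mem_ofFn] at hA
        obtain ⟨k, rfl⟩ := hA
        exact ⟨hM0 _, hM1 _⟩)
    refine ⟨δ * D K gs + (1 - δ) * m - (ρseq (K + n + 1) - ρseq (K + 1)), fun γ => ?_⟩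
    have u1 := onep_avg _ ((hst φ).1 γ) ((hst φ).2 γ) δ gs (hδ φ γ) (D K) (m + s)
      (fun g => (hm g).2)
    have l1 := onep_avg _ ((hst ψ).1 γ) ((hst ψ).2 γ) δ gs (hδ ψ γ) (fun g => - D K g) (-m)
      (fun g => neg_le_neg (hm g).1)
    have u2 := hφ γ
    have l2 := hψ γ
    constructor
    · linarith
    · linarith
  have hB0 : ∃ s m, 0 ≤ s ∧ ∀ γ, m ≤ D 0 γ ∧ D 0 γ ≤ m + s := by
    obtain ⟨b, hb⟩ := (Set.finite_range (D 0)).bddAbove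
    obtain ⟨m, hm⟩ := (Set.finite_range (D 0)).bddBelow
    refine ⟨b - m, m, ?_, fun γ => ⟨hm ⟨γ, rfl⟩, ?_⟩⟩
    · have h1 := hb ⟨γr, rfl⟩
      have h2 := hm ⟨γr, rfl⟩
      linarith
    · have h1 := hb ⟨γ, rfl⟩
      linarith
  obtain ⟨s, m0, hs, hm0⟩ := hB0
  have hBj : ∀ j, ∃ m, ∀ γ, m ≤ D j γ ∧ D j γ ≤ m + s := by
    intro j
    have := hstep j 0 γstar (fun φ γ => (onep_prod (List.ofFn (fun k => M (φ k))) (by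
        intro A hA
        rw [List.mem_ofFn] at hA
        obtain ⟨k, rfl⟩ := hA
        exact ⟨hM0 _, hM1 _⟩)).1 γ γstar) 0 s ⟨m0, hm0⟩
    simpa using this
  have hBn : ∀ n j, ∃ m, ∀ γ, m ≤ D (j + L * n) γ ∧ D (j + L * n) γ ≤ m + (1 - ε) ^ n * s := by
    intro n j
    induction n with
    | zero => simpa using hBj j
    | succ n ih =>
      have := hstep L ε γstar hDoeblin _ _ ih
      have e : j + L * (n + 1) = j + L * n + L := by ring
      rw [e, pow_succ', mul_assoc]
      exact this
  have hε' : 0 < 1 - ε := by linarith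
  set θ : ℝ := (1 - ε) ^ ((L : ℝ)⁻¹) with hθ
  have hθ0 : 0 < θ := Real.rpow_pos_of_pos hε' _
  have hLpos : (0 : ℝ) < L := by exact_mod_cast hL
  have hθ1 : θ < 1 := Real.rpow_lt_one hε'.le (by linarith) (inv_pos.2 hLpos)
  have hθL : θ ^ L = 1 - ε := Real.rpow_inv_natCast_pow hε'.le (by omega)
  have hDb : ∀ γ K, dist (W K γ) (W (K + 1) γ) ≤ (s / (1 - ε)) * θ ^ K := by
    intro γ K
    obtain ⟨m, hm⟩ := hBn (K / L) (K % L)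
    rw [Nat.mod_add_div] at hm
    have hr : D K γr = 0 := by simp only [hDdef, hWr, sub_zero]
    have h1 := hm γr
    have h2 := hm γ
    rw [hr] at h1
    have h3 : dist (W K γ) (W (K + 1) γ) ≤ (1 - ε) ^ (K / L) * s := by
      rw [dist_comm, Real.dist_eq]
      change |D K γ| ≤ _
      rw [abs_le]
      constructor <;> linarith
    refine h3.trans ?_
    have h4 : (1 - ε) ^ (K / L) * (1 - ε) ≤ θ ^ K := by
      rw [← pow_succ, ← hθL, ← pow_mul]
      apply pow_le_pow_of_le_one hθ0.le hθ1.le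
      exact (Nat.lt_mul_div_succ K (by omega)).le
    rw [div_mul_eq_mul_div, le_div_iff₀ hε']
    nlinarith
  have hconv : ∀ γ, ∃ w, Filter.Tendsto (fun K => W K γ) Filter.atTop (nhds w) := fun γ =>
    cauchySeq_tendsto_of_complete (cauchySeq_of_le_geometric θ _ hθ1 (hDb γ))
  choose w hw using hconv
  have hinf : ∀ γ, Filter.Tendsto
      (fun K => Finset.univ.inf' Finset.univ_nonempty (G K γ)) Filter.atTop
      (nhds (Finset.univ.inf' Finset.univ_nonempty
        (fun a => (q γ a - c * w γ + c * ∑ γ', P γ a γ' * w γ') / f a))) := by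
    intro γ
    have := Filter.Tendsto.finset_inf'_nhds (s := (Finset.univ : Finset Act)) Finset.univ_nonempty
      (f := fun a K => G K γ a) (l := Filter.atTop)
      (g := fun a => (q γ a - c * w γ + c * ∑ γ', P γ a γ' * w γ') / f a) (by
        intro a _
        refine Filter.Tendsto.div_const ?_ _
        refine Filter.Tendsto.add (tendsto_const_nhds.sub ((hw γ).const_mul c)) ?_
        exact (tendsto_finsetSum _ (fun j _ => (hw j).const_mul _)).const_mul c)
    refine this.congr (fun K => ?_)
    first
      | rfl
      | simp [Finset.inf'_apply]
  have hwr : w γr = 0 := by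
    refine tendsto_nhds_unique (hw γr) ?_
    simp only [hWr]
    exact tendsto_const_nhds
  set R := Finset.univ.inf' Finset.univ_nonempty
        (fun a => (q γr a - c * w γr + c * ∑ γ', P γr a γ' * w γ') / f a) with hR
  have hρ1 : Filter.Tendsto (fun K => ρseq (K + 1)) Filter.atTop (nhds R) := by
    have := hinf γr
    refine this.congr (fun K => ?_)
    rw [hρrec', hWr, zero_add]
  have hfix : ∀ γ, R = Finset.univ.inf' Finset.univ_nonempty
        (fun a => (q γ a - c * w γ + c * ∑ γ', P γ a γ' * w γ') / f a) := by
    intro γ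
    have h1 := ((hw γ).add (hinf γ)).sub hρ1
    have h2 := (hw γ).comp (Filter.tendsto_add_atTop_nat 1)
    have h3 := tendsto_nhds_unique h2 (h1.congr (fun K => (hWrec' K γ).symm))
    linarith
  refine ⟨R, w, (Filter.tendsto_add_atTop_iff_nat 1).1 hρ1, hw, ?_, ?_⟩
  · intro γ
    apply le_antisymm
    · apply Finset.le_inf'
      intro a _
      have h1 : R ≤ (q γ a - c * w γ + c * ∑ γ', P γ a γ' * w γ') / f a := by
        rw [hfix γ]
        exact Finset.inf'_le _ (Finset.mem_univ a)
      rw [le_div_iff₀ (hf a)] at h1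
      linarith
    · obtain ⟨a, -, ha⟩ := Finset.exists_mem_eq_inf' (s := (Finset.univ : Finset Act))
        Finset.univ_nonempty
        (fun a => (q γ a - c * w γ + c * ∑ γ', P γ a γ' * w γ') / f a)
      rw [← hfix γ, eq_div_iff (hf a).ne'] at ha
      refine (Finset.inf'_le _ (Finset.mem_univ a)).trans ?_
      linarith
  · rw [hR, hwr]
    simp only [mul_zero, sub_zero]
end

section
/- Under the Doeblin condition, the OnePDSI error decays geometrically: there exists a constant M ≥ 0 such that for every K ≥ 1, |ρ_K − ρ_∞| ≤ M·(1−ε)^{(K−1)/L} / ( 1 − (1−ε)^{1/L} ), where ρ_∞ is the limit of the sequence (ρ_K). In particular the worst-case optimality gap decays as O(1/R^K) with asymptotic rate R = (1−ε)^{−1/L} > 1, so a prescribed accuracy δ is reached within O(log(1/δ)) iterations. (Theorem 6: upper bound on the relative error of OnePDSI.) -/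
open Matrix in
lemma aux_mulVec_le {Γ : Type*} [Fintype Γ] (A : Matrix Γ Γ ℝ) (D : Γ → ℝ) (u e : ℝ) (g : Γ)
    (hA : ∀ i j, 0 ≤ A i j) (hr : ∀ i, ∑ j, A i j = 1) (he : ∀ i, e ≤ A i g)
    (hD : ∀ i, D i ≤ u) (i : Γ) : (A *ᵥ D) i ≤ e * D g + (1 - e) * u := by
  have h1 : (A *ᵥ D) i = u - ∑ j, A i j * (u - D j) := by
    have : ∑ j, A i j * (u - D j) = (∑ j, A i j) * u - ∑ j, A i j * D j := by
      rw [Finset.sum_mul, ← Finset.sum_sub_distrib]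
      exact Finset.sum_congr rfl fun j _ => by ring
    rw [this, hr]
    simp [Matrix.mulVec, dotProduct]
  have h2 : A i g * (u - D g) ≤ ∑ j, A i j * (u - D j) :=
    Finset.single_le_sum (f := fun j => A i j * (u - D j))
      (fun j _ => mul_nonneg (hA i j) (sub_nonneg.2 (hD j))) (Finset.mem_univ g)
  have h3 : e * (u - D g) ≤ A i g * (u - D g) :=
    mul_le_mul_of_nonneg_right (he i) (sub_nonneg.2 (hD g))
  rw [h1]; nlinarith

open Matrix in
lemma aux_osc {Γ : Type*} [Fintype Γ] [Nonempty Γ] (A B : Matrix Γ Γ ℝ) (D : Γ → ℝ) (s e : ℝ)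
    (g : Γ)
    (hA : ∀ i j, 0 ≤ A i j) (hr : ∀ i, ∑ j, A i j = 1) (he : ∀ i, e ≤ A i g)
    (hB : ∀ i j, 0 ≤ B i j) (hrB : ∀ i, ∑ j, B i j = 1) (heB : ∀ i, e ≤ B i g)
    (he1 : e ≤ 1)
    (hD : ∀ i j, D i - D j ≤ s) (i j : Γ) : (A *ᵥ D) i - (B *ᵥ D) j ≤ (1 - e) * s := by
  obtain ⟨x, hx⟩ := Finite.exists_max D
  obtain ⟨y, hy⟩ := Finite.exists_min D
  have h1 := aux_mulVec_le A D (D x) e g hA hr he hx i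
  have h2 := aux_mulVec_le B (-D) (-D y) e g hB hrB heB (fun i => by simpa using hy i) j
  rw [Matrix.mulVec_neg] at h2
  simp only [Pi.neg_apply] at h2
  have h3 := mul_le_mul_of_nonneg_left (hD x y) (sub_nonneg.2 he1)
  nlinarith

open Matrix in
lemma aux_prod {Γ Act : Type*} [Fintype Γ] [DecidableEq Γ] (M : (Γ → Act) → Matrix Γ Γ ℝ)
    (hnn : ∀ φ i j, 0 ≤ M φ i j) (hr : ∀ φ i, ∑ j, M φ i j = 1) :
    ∀ (n : ℕ) (φ : Fin n → (Γ → Act)),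
      (∀ i j, 0 ≤ ((List.ofFn (fun k => M (φ k))).prod) i j) ∧
      (∀ i, ∑ j, ((List.ofFn (fun k => M (φ k))).prod) i j = 1) := by
  intro n
  induction n with
  | zero =>
    intro φ
    simp [Matrix.one_apply]
    intro i j; split_ifs <;> norm_num
  | succ n ih =>
    intro φ
    obtain ⟨h1, h2⟩ := ih (fun k => φ k.succ)
    rw [List.ofFn_succ, List.prod_cons]
    constructor
    · intro i j
      rw [Matrix.mul_apply]
      exact Finset.sum_nonneg fun k _ => mul_nonneg (hnn _ _ _) (h1 _ _)
    · intro i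
      simp_rw [Matrix.mul_apply]
      rw [Finset.sum_comm]
      simp_rw [← Finset.mul_sum, h2, mul_one]
      exact hr _ _

open Matrix in
lemma aux_iter {Γ Act : Type*} [Fintype Γ] [DecidableEq Γ] (M : (Γ → Act) → Matrix Γ Γ ℝ)
    (hnn : ∀ φ i j, 0 ≤ M φ i j) (hr : ∀ φ i, ∑ j, M φ i j = 1)
    (D : ℕ → Γ → ℝ) (r : ℕ → ℝ)
    (hD : ∀ K, ∃ φ, ∀ i, D (K + 1) i ≤ (M φ *ᵥ D K) i - (r (K + 1) - r K)) (K : ℕ) :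
    ∀ n : ℕ, ∃ φ : Fin n → (Γ → Act), ∀ i,
      D (K + n) i ≤ ((List.ofFn (fun k => M (φ k))).prod *ᵥ D K) i - (r (K + n) - r K) := by
  intro n
  induction n with
  | zero => exact ⟨fun k => k.elim0, fun i => by simp⟩
  | succ n ih =>
    obtain ⟨φ, hφ⟩ := ih
    obtain ⟨ψ, hψ⟩ := hD (K + n)
    refine ⟨Fin.cons ψ φ, fun i => ?_⟩
    rw [List.ofFn_succ, List.prod_cons]
    simp only [Fin.cons_zero, Fin.cons_succ]
    rw [← Matrix.mulVec_mulVec]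
    set V := (List.ofFn (fun k => M (φ k))).prod *ᵥ D K with hV
    have h1 := hψ i
    have h2 : (M ψ *ᵥ D (K + n)) i ≤ (M ψ *ᵥ V) i - (r (K + n) - r K) := by
      have : (M ψ *ᵥ V) i - (r (K + n) - r K)
          = ∑ j, M ψ i j * (V j - (r (K + n) - r K)) := by
        simp_rw [mul_sub (M ψ i _) (V _)]
        rw [Finset.sum_sub_distrib, ← Finset.sum_mul, hr, one_mul]
        rfl
      rw [this]
      exact Finset.sum_le_sum fun j _ => mul_le_mul_of_nonneg_left (hφ j) (hnn _ _ _)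
    rw [← add_assoc]
    linarith


/-- Theorem 6: under the Doeblin condition, the OnePDSI error decays geometrically:
there is a constant `C ≥ 0` with `|ρ_K − ρ_∞| ≤ C·(1−ε)^((K−1)/L) / (1 − (1−ε)^(1/L))`
for every `K ≥ 1`, where `ρ_∞` is the limit of the sequence. -/
theorem onePDSI_geometric_error_bound
    {Γ Act : Type*} [Fintype Γ] [Nonempty Γ] [DecidableEq Γ] [Fintype Act] [Nonempty Act]
    (q : Γ → Act → ℝ) (f : Act → ℝ) (c : ℝ)
    (hc0 : 0 < c) (hcf : ∀ a, c < f a)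
    (P : Γ → Act → Γ → ℝ)
    (hPnn : ∀ γ a γ', 0 ≤ P γ a γ') (hProw : ∀ γ a, ∑ γ', P γ a γ' = 1)
    (γr : Γ) (W : ℕ → Γ → ℝ) (ρseq : ℕ → ℝ)
    (hW0 : W 0 γr = 0)
    (hρrec : ∀ K, ρseq (K + 1) = W K γr + Finset.univ.inf' Finset.univ_nonempty
        (fun a => (q γr a - c * W K γr + c * ∑ γ', P γr a γ' * W K γ') / f a))
    (hWrec : ∀ K γ, W (K + 1) γ = W K γ + Finset.univ.inf' Finset.univ_nonempty
        (fun a => (q γ a - c * W K γ + c * ∑ γ', P γ a γ' * W K γ') / f a)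
        - ρseq (K + 1))
    (M : (Γ → Act) → Matrix Γ Γ ℝ)
    (hM : ∀ φ γ γ', M φ γ γ' =
      (1 - c / f (φ γ)) * (if γ' = γ then 1 else 0) + (c / f (φ γ)) * P γ (φ γ) γ')
    (L : ℕ) (hL : 1 ≤ L) (ε : ℝ) (hε0 : 0 < ε) (hε1 : ε < 1) (γstar : Γ)
    (hDoeblin : ∀ φ : Fin L → (Γ → Act), ∀ γ,
        ε ≤ ((List.ofFn (fun k => M (φ k))).prod) γ γstar) :
    ∃ (ρinf : ℝ), Filter.Tendsto ρseq Filter.atTop (nhds ρinf) ∧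
      ∃ C : ℝ, 0 ≤ C ∧ ∀ K : ℕ, 1 ≤ K →
        |ρseq K - ρinf| ≤
          C * (1 - ε) ^ (((K : ℝ) - 1) / (L : ℝ)) /
            (1 - (1 - ε) ^ ((1 : ℝ) / (L : ℝ))) := by
  have hf : ∀ a, 0 < f a := fun a => hc0.trans (hcf a)
  have hnn : ∀ φ i j, 0 ≤ M φ i j := by
    intro φ i j
    rw [hM]
    have h1 : c / f (φ i) ≤ 1 := (div_le_one (hf _)).2 (hcf _).le
    have h2 : 0 ≤ c / f (φ i) := div_nonneg hc0.le (hf _).le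
    have h3 := hPnn i (φ i) j
    refine add_nonneg (mul_nonneg (by linarith) (by split_ifs <;> norm_num)) (mul_nonneg h2 h3)
  have hr : ∀ φ i, ∑ j, M φ i j = 1 := by
    intro φ i
    simp_rw [hM]
    rw [Finset.sum_add_distrib, ← Finset.mul_sum, ← Finset.mul_sum, hProw]
    simp
  have hMV : ∀ φ (V : Γ → ℝ) i, (M φ).mulVec V i
      = V i + (- c * V i + c * ∑ j, P i (φ i) j * V j) / f (φ i) := by
    intro φ V i
    simp only [Matrix.mulVec, dotProduct, hM]
    simp_rw [add_mul, mul_assoc]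
    rw [Finset.sum_add_distrib, ← Finset.mul_sum, ← Finset.mul_sum]
    simp
    ring
  obtain ⟨T, hT⟩ : ∃ T : (Γ → ℝ) → Γ → ℝ, ∀ V γ, T V γ =
      V γ + Finset.univ.inf' Finset.univ_nonempty
        (fun a => (q γ a - c * V γ + c * ∑ γ', P γ a γ' * V γ') / f a) := ⟨_, fun _ _ => rfl⟩
  have hgreedy : ∀ V, ∃ φ : Γ → Act, ∀ U γ, T U γ - T V γ ≤ (M φ).mulVec (U - V) γ := by
    intro V
    have : ∀ γ, ∃ a, Finset.univ.inf' Finset.univ_nonempty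
        (fun a => (q γ a - c * V γ + c * ∑ γ', P γ a γ' * V γ') / f a)
        = (q γ a - c * V γ + c * ∑ γ', P γ a γ' * V γ') / f a := by
      intro γ
      obtain ⟨a, -, ha⟩ := Finset.exists_mem_eq_inf' (Finset.univ_nonempty (α := Act))
        (fun a => (q γ a - c * V γ + c * ∑ γ', P γ a γ' * V γ') / f a)
      exact ⟨a, ha⟩
    choose φ hφ using this
    refine ⟨φ, fun U γ => ?_⟩
    have h1 := Finset.inf'_le (fun a => (q γ a - c * U γ + c * ∑ γ', P γ a γ' * U γ') / f a)
      (Finset.mem_univ (φ γ))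
    rw [Matrix.mulVec_sub, Pi.sub_apply, hMV, hMV, hT, hT, hφ]
    have h2 : ∀ x : ℝ, (q γ (φ γ) - c * U γ + x) / f (φ γ)
        = q γ (φ γ) / f (φ γ) + (- c * U γ + x) / f (φ γ) := fun x => by ring
    have h3 : ∀ x : ℝ, (q γ (φ γ) - c * V γ + x) / f (φ γ)
        = q γ (φ γ) / f (φ γ) + (- c * V γ + x) / f (φ γ) := fun x => by ring
    rw [h3]
    simp only [h2] at h1
    linarith
  have hρT : ∀ K, ρseq (K + 1) = T (W K) γr := fun K => by rw [hρrec, hT]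
  have hWT : ∀ K γ, W (K + 1) γ = T (W K) γ - ρseq (K + 1) := fun K γ => by rw [hWrec, hT]
  have hWr : ∀ K, W K γr = 0 := by
    intro K
    cases K with
    | zero => exact hW0
    | succ K => rw [hWT, hρT, sub_self]
  obtain ⟨D, hDdef⟩ : ∃ D : ℕ → Γ → ℝ, ∀ K, D K = W (K + 1) - W K := ⟨_, fun _ => rfl⟩
  have hDr : ∀ K, D K γr = 0 := fun K => by simp [hDdef, hWr]
  have hDstep : ∀ K γ, D (K + 1) γ = T (W (K + 1)) γ - T (W K) γ
      - (ρseq (K + 1 + 1) - ρseq (K + 1)) := by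
    intro K γ
    rw [hDdef, Pi.sub_apply, hWT (K + 1), hWT K]; ring
  have hup : ∀ K, ∃ φ, ∀ i, D (K + 1) i ≤ (M φ).mulVec (D K) i
      - ((fun k => ρseq (k + 1)) (K + 1) - (fun k => ρseq (k + 1)) K) := by
    intro K
    obtain ⟨φ, hφ⟩ := hgreedy (W K)
    refine ⟨φ, fun i => ?_⟩
    have := hφ (W (K + 1)) i
    rw [← hDdef] at this
    rw [hDstep]
    simp only
    linarith
  have hlo : ∀ K, ∃ φ, ∀ i, (fun k => - D k) (K + 1) i ≤ (M φ).mulVec ((fun k => - D k) K) i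
      - ((fun k => - ρseq (k + 1)) (K + 1) - (fun k => - ρseq (k + 1)) K) := by
    intro K
    obtain ⟨φ, hφ⟩ := hgreedy (W (K + 1))
    refine ⟨φ, fun i => ?_⟩
    have := hφ (W K) i
    rw [← neg_sub (W (K + 1)), ← hDdef] at this
    simp only [Pi.neg_apply]
    rw [hDstep]
    linarith
  have key : ∀ (n : ℕ) (e : ℝ), e ≤ 1 →
      (∀ φ : Fin n → (Γ → Act), ∀ γ, e ≤ ((List.ofFn (fun k => M (φ k))).prod) γ γstar) →
      ∀ K s, (∀ i j, D K i - D K j ≤ s) → ∀ i j, D (K + n) i - D (K + n) j ≤ (1 - e) * s := by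
    intro n e he1 he K s hs i j
    obtain ⟨φ, hφ⟩ := aux_iter M hnn hr D (fun k => ρseq (k + 1)) hup K n
    obtain ⟨ψ, hψ⟩ := aux_iter M hnn hr (fun k => - D k) (fun k => - ρseq (k + 1)) hlo K n
    obtain ⟨a1, a2⟩ := aux_prod M hnn hr n φ
    obtain ⟨b1, b2⟩ := aux_prod M hnn hr n ψ
    have h := aux_osc _ _ (D K) s e γstar a1 a2 (he φ) b1 b2 (he ψ) he1 hs i j
    have h1 := hφ i
    have h2 := hψ j
    rw [Matrix.mulVec_neg] at h2
    simp only [Pi.neg_apply] at h1 h2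
    linarith
  obtain ⟨s0, hs0, hosc0⟩ : ∃ s0 : ℝ, 0 ≤ s0 ∧ ∀ i j, D 0 i - D 0 j ≤ s0 := by
    refine ⟨∑ k, |D 0 k| + ∑ k, |D 0 k|, by positivity, fun i j => ?_⟩
    have h1 := Finset.single_le_sum (f := fun k => |D 0 k|) (fun k _ => abs_nonneg _)
      (Finset.mem_univ i)
    have h2 := Finset.single_le_sum (f := fun k => |D 0 k|) (fun k _ => abs_nonneg _)
      (Finset.mem_univ j)
    have h3 := le_abs_self (D 0 i)
    have h4 := neg_abs_le (D 0 j)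
    linarith
  have hosc : ∀ K i j, D K i - D K j ≤ s0 := by
    intro K i j
    have := key K 0 zero_le_one (fun φ γ => (aux_prod M hnn hr K φ).1 _ _) 0 s0 hosc0 i j
    simpa using this
  have he0 : 0 < 1 - ε := by linarith
  have hLpos : (0 : ℝ) < L := by exact_mod_cast hL
  obtain ⟨r, hrdef⟩ : ∃ r : ℝ, r = (1 - ε) ^ ((1 : ℝ) / (L : ℝ)) := ⟨_, rfl⟩
  have hr0 : 0 < r := by rw [hrdef]; exact Real.rpow_pos_of_pos he0 _
  have hr1 : r < 1 := by
    rw [hrdef]; exact Real.rpow_lt_one he0.le (by linarith) (by positivity)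
  have hrpow : ∀ n : ℕ, r ^ n = (1 - ε) ^ ((n : ℝ) / (L : ℝ)) := by
    intro n
    rw [hrdef, ← Real.rpow_natCast, ← Real.rpow_mul he0.le]
    congr 1; ring
  have hrL : r ^ L = 1 - ε := by
    rw [hrpow, div_self hLpos.ne', Real.rpow_one]
  have hgeo : ∀ K i j, D K i - D K j ≤ s0 / (1 - ε) * r ^ K := by
    intro K
    induction K using Nat.strong_induction_on with
    | _ K ih =>
      intro i j
      by_cases hK : K < L
      · refine (hosc K i j).trans ?_
        have : 1 - ε ≤ r ^ K := by
          rw [← hrL]; exact pow_le_pow_of_le_one hr0.le hr1.le hK.le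
        rw [div_mul_eq_mul_div, le_div_iff₀ he0]
        exact mul_le_mul_of_nonneg_left this hs0
      · obtain ⟨k, rfl⟩ := Nat.exists_eq_add_of_le' (not_lt.1 hK)
        have := key L ε hε1.le hDoeblin k _ (ih k (by omega)) i j
        rw [pow_add, hrL]
        linarith
  have hρ : ∀ K, dist (ρseq (K + 1)) (ρseq (K + 1 + 1)) ≤ s0 / (1 - ε) * r ^ K := by
    intro K
    have hb := hgeo K
    rw [Real.dist_eq, abs_le]
    obtain ⟨φ, hφ⟩ := hup K
    obtain ⟨ψ, hψ⟩ := hlo K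
    have h1 := hφ γr
    have h2 := hψ γr
    simp only [Pi.neg_apply, hDr] at h1 h2
    have h3 := aux_mulVec_le (M φ) (D K) (s0 / (1 - ε) * r ^ K) 0 γr (hnn φ) (hr φ)
      (fun i => hnn _ _ _) (fun i => by have := hb i γr; rw [hDr] at this; linarith) γr
    have h4 := aux_mulVec_le (M ψ) (-D K) (s0 / (1 - ε) * r ^ K) 0 γr (hnn ψ) (hr ψ)
      (fun i => hnn _ _ _)
      (fun i => by have := hb γr i; rw [hDr] at this; simp only [Pi.neg_apply]; linarith) γr
    constructor <;> linarith
  have hcau := cauchySeq_of_le_geometric r _ hr1 hρ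
  obtain ⟨ρinf, hlim⟩ := cauchySeq_tendsto_of_complete hcau
  refine ⟨ρinf, (Filter.tendsto_add_atTop_iff_nat 1).1 hlim, s0 / (1 - ε), by positivity, ?_⟩
  intro K hK
  obtain ⟨k, rfl⟩ := Nat.exists_eq_add_of_le' hK
  have := dist_le_of_le_geometric_of_tendsto r _ hr1 hρ hlim k
  rw [Real.dist_eq, hrpow] at this
  rw [← hrdef]
  push_cast
  rw [add_sub_cancel_right]
  exact this
end
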